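/- arXiv:2308.12974 — 9 statements merged into one kernel-verified Lean document; each statement's English description precedes it below -/
import Mathlib

section
/- Let m > 1 and μ₀ be real constants with μ₀ − (m−1)²/4 > 1, and let q₀ : (0,∞) → ℝ be a C¹ function with lim_{t→0⁺} q₀(t) = 0. If w : (0,∞) → ℝ is a C² solution of the ODE w''(t) + m t^{−1} w'(t) + t^{−2}(μ₀ + q₀(t)) w(t) = 0 on (0,∞) which is not identically zero, then lim_{t→0⁺} (|w(t)|² + t²|w'(t)|²) = +∞ and limsup_{t→0⁺} |w(t)|² = +∞. -/
open Set Filter Topology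

/-- Integrated form of the differential inequality `t F' ≤ -c F`: the function `t ^ c * F t` is
nonincreasing. -/
theorem rpow_mul_le_rpow_mul_of_hasDerivAt_le {F F' : ℝ → ℝ} {c s T : ℝ} (hs : 0 < s) (hsT : s ≤ T)
    (hF : ∀ t ∈ Icc s T, HasDerivAt F (F' t) t) (hle : ∀ t ∈ Icc s T, t * F' t ≤ -c * F t) :
    T ^ c * F T ≤ s ^ c * F s := by
  have hder : ∀ t ∈ Icc s T,
      HasDerivAt (fun t : ℝ => t ^ c * F t) (c * t ^ (c - 1) * F t + t ^ c * F' t) t := by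
    intro t ht
    have ht0 : t ≠ 0 := (hs.trans_le ht.1).ne'
    exact (Real.hasDerivAt_rpow_const (Or.inl ht0)).mul (hF t ht)
  have hanti : AntitoneOn (fun t : ℝ => t ^ c * F t) (Icc s T) := by
    refine antitoneOn_of_deriv_nonpos (convex_Icc s T)
      (fun t ht => (hder t ht).continuousAt.continuousWithinAt)
      (fun t ht => (hder t (interior_subset ht)).differentiableAt.differentiableWithinAt) ?_
    intro t ht
    have ht' := interior_subset ht
    have ht0 : 0 < t := hs.trans_le ht'.1
    rw [(hder t ht').deriv]
    have hpow : t ^ c = t ^ (c - 1) * t := by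
      rw [← Real.rpow_add_one ht0.ne', sub_add_cancel]
    have hpos : 0 < t ^ (c - 1) := Real.rpow_pos_of_pos ht0 _
    have := mul_le_mul_of_nonneg_left (hle t ht') hpos.le
    rw [hpow]
    linarith
  exact hanti (left_mem_Icc.2 hsT) (right_mem_Icc.2 hsT) hsT

/-- A function with `t f' ≥ 1` on `(0, d)` is not bounded below there. -/
theorem exists_lt_of_one_le_mul_hasDerivAt {f f' : ℝ → ℝ} {d : ℝ} (hd : 0 < d)
    (hf : ∀ t ∈ Ioo 0 d, HasDerivAt f (f' t) t) (hle : ∀ t ∈ Ioo 0 d, 1 ≤ t * f' t) (B : ℝ) :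
    ∃ t ∈ Ioo 0 d, f t < B := by
  have hder : ∀ t ∈ Ioo 0 d, HasDerivAt (fun t => f t - Real.log t) (f' t - t⁻¹) t :=
    fun t ht => (hf t ht).sub (Real.hasDerivAt_log ht.1.ne')
  have hmono : MonotoneOn (fun t => f t - Real.log t) (Ioo 0 d) := by
    refine monotoneOn_of_deriv_nonneg (convex_Ioo 0 d)
      (fun t ht => (hder t ht).continuousAt.continuousWithinAt)
      (fun t ht => (hder t (interior_subset ht)).differentiableAt.differentiableWithinAt) ?_
    intro t ht
    have ht' := interior_subset ht
    rw [(hder t ht').deriv, sub_nonneg, inv_le_iff_one_le_mul₀' ht'.1]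
    exact hle t ht'
  have hmid : d / 2 ∈ Ioo 0 d := ⟨by linarith, by linarith⟩
  have hlog : ∀ᶠ t in 𝓝[>] (0 : ℝ), Real.log t < B - (f (d / 2) - Real.log (d / 2)) :=
    Real.tendsto_log_nhdsGT_zero.eventually_lt_atBot _
  obtain ⟨t, hlt, ht⟩ := (hlog.and (Ioo_mem_nhdsGT hmid.1)).exists
  have ht' : t ∈ Ioo 0 d := ⟨ht.1, ht.2.trans hmid.2⟩
  have := hmono ht' hmid ht.2.le
  exact ⟨t, ht', by dsimp only at this; linarith⟩

/-- A function with continuous derivative such that `(t f')² ≥ 1` on `(0, d)` is unbounded there. -/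
theorem exists_lt_sq_of_one_le_sq_mul {f f' : ℝ → ℝ} {d : ℝ} (hd : 0 < d)
    (hf : ∀ t ∈ Ioo 0 d, HasDerivAt f (f' t) t) (hcont : ContinuousOn f' (Ioo 0 d))
    (hle : ∀ t ∈ Ioo 0 d, 1 ≤ (t * f' t) ^ 2) (M : ℝ) :
    ∃ t ∈ Ioo 0 d, M < f t ^ 2 := by
  have hsign : (∀ t ∈ Ioo 0 d, 1 ≤ t * f' t) ∨ ∀ t ∈ Ioo 0 d, t * f' t ≤ -1 := by
    by_contra! h
    obtain ⟨⟨r, hr, hr1⟩, t, ht, ht1⟩ := h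
    have hr0 : r * f' r ≤ 0 := by nlinarith [hle r hr]
    have ht0 : 0 ≤ t * f' t := by nlinarith [hle t ht]
    obtain ⟨x, hx, hx0⟩ := isPreconnected_Ioo.intermediate_value hr ht
      (continuousOn_id.mul hcont) ⟨hr0, ht0⟩
    have := hle x hx
    simp only [Pi.mul_apply, id] at hx0
    rw [hx0] at this
    norm_num at this
  rcases hsign with h | h
  · obtain ⟨t, ht, hlt⟩ := exists_lt_of_one_le_mul_hasDerivAt hd hf h (-(|M| + 1))
    exact ⟨t, ht, by nlinarith [le_abs_self M, abs_nonneg M]⟩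
  · obtain ⟨t, ht, hlt⟩ := exists_lt_of_one_le_mul_hasDerivAt (f := fun t => -f t)
      (f' := fun t => -f' t) hd (fun t ht => (hf t ht).neg)
      (fun t ht => by linarith [h t ht]) (-(|M| + 1))
    exact ⟨t, ht, by nlinarith [le_abs_self M, abs_nonneg M]⟩

/-- Derivative of the energy `(t w' + a w)² + k w²` along `w'' + m t⁻¹ w' + t⁻² (μ + q) w = 0`,
where `a = (m - 1) / 2` and `k = μ - a²`. -/
theorem hasDerivAt_energy {m μ q t : ℝ} {w v : ℝ → ℝ} {v' : ℝ} (ht : t ≠ 0)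
    (hw : HasDerivAt w (v t) t) (hv : HasDerivAt v v' t)
    (hode : v' + m * t⁻¹ * v t + (t ^ 2)⁻¹ * (μ + q) * w t = 0) :
    HasDerivAt (fun t => (t * v t + (m - 1) / 2 * w t) ^ 2 + (μ - (m - 1) ^ 2 / 4) * w t ^ 2)
      ((-(m - 1) * ((t * v t + (m - 1) / 2 * w t) ^ 2 + (μ - (m - 1) ^ 2 / 4) * w t ^ 2)
        - 2 * q * ((t * v t + (m - 1) / 2 * w t) * w t)) / t) t := by
  have h := ((((hasDerivAt_id t).mul hv).add (hw.const_mul ((m - 1) / 2))).pow 2).add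
    ((hw.pow 2).const_mul (μ - (m - 1) ^ 2 / 4))
  refine h.congr_deriv ?_
  have hv' : v' = -(m * t⁻¹ * v t + (t ^ 2)⁻¹ * (μ + q) * w t) := by linarith
  simp only [Pi.add_apply, Pi.mul_apply, id, hv']
  field_simp
  ring

/-- Theorem 4.1 (big bang behaviour of temporal eigenfunctions for `3 ≤ n ≤ 16`):
if `m > 1`, `μ₀ − (m-1)²/4 > 1`, `q₀` is `C¹` on `(0,∞)` with `q₀(t) → 0` as `t → 0⁺`,
and `w` is a nontrivial `C²` solution of
`w'' + m t⁻¹ w' + t⁻²(μ₀ + q₀(t)) w = 0` on `(0,∞)`, then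
`|w|² + t²|w'|² → ∞` as `t → 0⁺` and `limsup_{t→0⁺} |w|² = ∞`
(i.e. `|w|²` is unbounded on every interval `(0,δ)`). -/
theorem stmt3 (m μ₀ : ℝ) (hm : 1 < m) (hμ : 1 < μ₀ - (m - 1) ^ 2 / 4)
    (q₀ : ℝ → ℝ) (hq₀ : ContDiffOn ℝ 1 q₀ (Ioi 0))
    (hq₀lim : Tendsto q₀ (nhdsWithin 0 (Ioi 0)) (nhds 0))
    (w : ℝ → ℝ) (hw : ContDiffOn ℝ 2 w (Ioi 0))
    (hode : ∀ t ∈ Ioi (0 : ℝ),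
      deriv (deriv w) t + m * t⁻¹ * deriv w t + (t ^ 2)⁻¹ * (μ₀ + q₀ t) * w t = 0)
    (hnontriv : ∃ t ∈ Ioi (0 : ℝ), w t ≠ 0) :
    Tendsto (fun t => |w t| ^ 2 + t ^ 2 * |deriv w t| ^ 2)
        (nhdsWithin 0 (Ioi 0)) atTop ∧
    ∀ δ > (0 : ℝ), ∀ M : ℝ, ∃ t ∈ Ioo (0 : ℝ) δ, M < |w t| ^ 2 := by
  set a := (m - 1) / 2 with ha
  set k := μ₀ - (m - 1) ^ 2 / 4 with hk
  have ha0 : 0 < a := by linarith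
  have hw1 : ∀ t ∈ Ioi (0 : ℝ), HasDerivAt w (deriv w t) t := fun t ht =>
    ((hw.differentiableOn (by norm_num)).differentiableAt (Ioi_mem_nhds ht)).hasDerivAt
  have hdw : ContDiffOn ℝ 1 (deriv w) (Ioi 0) := hw.deriv_of_isOpen isOpen_Ioi (by norm_num)
  have hw2 : ∀ t ∈ Ioi (0 : ℝ), HasDerivAt (deriv w) (deriv (deriv w) t) t := fun t ht =>
    ((hdw.differentiableOn (by norm_num)).differentiableAt (Ioi_mem_nhds ht)).hasDerivAt
  set F : ℝ → ℝ := fun t => (t * deriv w t + a * w t) ^ 2 + k * w t ^ 2 with hF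
  set F' : ℝ → ℝ := fun t =>
    (-(m - 1) * F t - 2 * q₀ t * ((t * deriv w t + a * w t) * w t)) / t with hF'
  have hFder : ∀ t ∈ Ioi (0 : ℝ), HasDerivAt F (F' t) t := fun t ht =>
    hasDerivAt_energy (ne_of_gt ht) (hw1 t ht) (hw2 t ht) (hode t ht)
  have hF'le : ∀ t ∈ Ioi (0 : ℝ), ∀ b, |q₀ t| ≤ b → t * F' t ≤ -(m - 1 - b) * F t := by
    intro t ht b hb
    have hcross : |2 * ((t * deriv w t + a * w t) * w t)| ≤ F t := by
      rw [abs_le]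
      constructor <;>
        nlinarith [sq_nonneg (t * deriv w t + a * w t + w t),
          sq_nonneg (t * deriv w t + a * w t - w t),
          mul_nonneg (sub_nonneg.2 hμ.le) (sq_nonneg (w t))]
    have hprod := mul_le_mul hb hcross (abs_nonneg _) ((abs_nonneg _).trans hb)
    rw [← abs_mul] at hprod
    have hmul : t * F' t = -(m - 1) * F t - 2 * q₀ t * ((t * deriv w t + a * w t) * w t) :=
      mul_div_cancel₀ _ (ne_of_gt ht)
    rw [hmul]
    linarith [neg_le_of_abs_le hprod]
  obtain ⟨t₀, ht₀, hwt₀⟩ := hnontriv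
  have hFt₀ : 0 < F t₀ := by
    have : 0 < w t₀ ^ 2 := by positivity
    positivity
  have hFpos : ∀ s, 0 < s → s ≤ t₀ → 0 < F s := by
    intro s hs hst
    have hpos : ∀ t ∈ Icc s t₀, t ∈ Ioi (0 : ℝ) := fun t ht => hs.trans_le ht.1
    obtain ⟨b, hb⟩ := isCompact_Icc.exists_bound_of_continuousOn (hq₀.continuousOn.mono hpos)
    have := rpow_mul_le_rpow_mul_of_hasDerivAt_le hs hst (fun t ht => hFder t (hpos t ht))
      (fun t ht => hF'le t (hpos t ht) b (hb t ht))
    exact pos_of_mul_pos_right ((mul_pos (Real.rpow_pos_of_pos ht₀ _) hFt₀).trans_le this)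
      (Real.rpow_nonneg hs.le _)
  obtain ⟨d, hd, hqd⟩ : ∃ d > 0, ∀ t ∈ Ioo 0 d, |q₀ t| ≤ a := by
    have : ∀ᶠ t in 𝓝[>] (0 : ℝ), |q₀ t| ≤ a := by
      filter_upwards [hq₀lim.eventually (Metric.closedBall_mem_nhds 0 ha0)] with t ht
      simpa using ht
    obtain ⟨d, hd, h⟩ := mem_nhdsGT_iff_exists_Ioo_subset.1 this
    exact ⟨d, hd, h⟩
  obtain ⟨T, hT, hTd⟩ := exists_between (lt_min hd ht₀)
  have hFT : 0 < F T := hFpos T hT (hTd.le.trans (min_le_right _ _))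
  have hgrow : ∀ s ∈ Ioo 0 T, T ^ a * F T * s ^ (-a) ≤ F s := by
    intro s hs
    have hsub : ∀ t ∈ Icc s T, t ∈ Ioo 0 d := fun t ht =>
      ⟨hs.1.trans_le ht.1, ht.2.trans_lt (hTd.trans_le (min_le_left _ _))⟩
    have h := rpow_mul_le_rpow_mul_of_hasDerivAt_le hs.1 hs.2.le
      (fun t ht => hFder t (hsub t ht).1)
      (fun t ht => hF'le t (hsub t ht).1 a (hqd t (hsub t ht)))
    rw [show m - 1 - a = a by rw [ha]; ring] at h
    rw [Real.rpow_neg hs.1.le, ← div_eq_mul_inv, div_le_iff₀' (Real.rpow_pos_of_pos hs.1 _)]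
    exact h
  have hC : 0 < 2 + 2 * a ^ 2 + k := by positivity
  have hlim : Tendsto (fun t => |w t| ^ 2 + t ^ 2 * |deriv w t| ^ 2) (𝓝[>] 0) atTop := by
    have hpow : Tendsto (fun s : ℝ => T ^ a * F T / (2 + 2 * a ^ 2 + k) * s ^ (-a))
        (𝓝[>] 0) atTop :=
      (tendsto_rpow_neg_nhdsGT_zero (neg_neg_of_pos ha0)).const_mul_atTop
        (div_pos (mul_pos (Real.rpow_pos_of_pos hT _) hFT) hC)
    refine tendsto_atTop_mono' _ ?_ hpow
    filter_upwards [Ioo_mem_nhdsGT hT] with s hs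
    rw [div_mul_eq_mul_div, div_le_iff₀' hC, sq_abs, sq_abs]
    refine (hgrow s hs).trans ?_
    have hk0 : 0 < k := by linarith
    have h1 := mul_nonneg hk0.le (sq_nonneg (s * deriv w s))
    have h2 := sq_nonneg (s * deriv w s - a * w s)
    have h3 := sq_nonneg (a * (s * deriv w s))
    have h4 := sq_nonneg (w s)
    simp only [hF]
    linarith
  refine ⟨hlim, fun δ hδ M => ?_⟩
  by_contra! hbdd
  obtain ⟨r, hr, hbig⟩ :=
    mem_nhdsGT_iff_exists_Ioo_subset.1 (hlim.eventually_ge_atTop (M + 1))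
  have hr0 : 0 < min r δ := lt_min hr hδ
  obtain ⟨t, ht, hMt⟩ := exists_lt_sq_of_one_le_sq_mul hr0 (fun t ht => hw1 t ht.1)
    (hdw.continuousOn.mono fun t ht => ht.1) (fun t ht => by
      have h1 := hbig ⟨ht.1, ht.2.trans_le (min_le_left _ _)⟩
      have h2 := hbdd t ⟨ht.1, ht.2.trans_le (min_le_right _ _)⟩
      simp only [mem_ofPred_eq, sq_abs] at h1 h2
      rw [mul_pow]
      linarith) M
  have := hbdd t ⟨ht.1, ht.2.trans_le (min_le_right _ _)⟩
  rw [sq_abs] at this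
  linarith
end

section
/- For every real-valued u ∈ C_c^∞((0,∞)) and every δ > 0, one has u(δ)² ≤ ∫₀^δ t |u'(t)|² dt + ∫₀^δ t^{−1} |u(t)|² dt. -/
open Set MeasureTheory

/-- A smooth real-valued function with compact support contained in `(0,∞)`. -/
def IsTestFun (u : ℝ → ℝ) : Prop :=
  ContDiff ℝ (⊤ : ℕ∞) u ∧ HasCompactSupport u ∧ tsupport u ⊆ Ioi 0

/-- The square of a test function on `(0,∞)`, divided by the variable, is continuous. -/
theorem IsTestFun.continuous_inv_mul_sq {u : ℝ → ℝ} (hu : IsTestFun u) :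
    Continuous fun t => t⁻¹ * |u t| ^ 2 := by
  refine continuous_of_tsupport fun x hx => ?_
  have hsub : tsupport (fun t => t⁻¹ * |u t| ^ 2) ⊆ tsupport u :=
    closure_mono fun t ht htu => ht (by simp [htu])
  have hx0 : x ≠ 0 := (hu.2.2 (hsub hx)).ne'
  exact (continuousAt_inv₀ hx0).mul (hu.1.continuous.abs.pow 2).continuousAt

/-- For every `u ∈ C_c^∞((0,∞))` and every `δ > 0`:
`u(δ)² ≤ ∫₀^δ t|u'|² dt + ∫₀^δ t⁻¹|u|² dt`. -/
theorem stmt6 (u : ℝ → ℝ) (hu : IsTestFun u) (δ : ℝ) (hδ : 0 < δ) :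
    u δ ^ 2 ≤ (∫ t in Ioo (0 : ℝ) δ, t * |deriv u t| ^ 2)
      + ∫ t in Ioo (0 : ℝ) δ, t⁻¹ * |u t| ^ 2 := by
  have hdiff : Differentiable ℝ u := hu.1.differentiable (by simp)
  have hcd : Continuous (deriv u) := hu.1.continuous_deriv (by simp)
  have hA : Continuous fun t => t * |deriv u t| ^ 2 := by fun_prop
  have hB := hu.continuous_inv_mul_sq
  have hu0 : u 0 = 0 := image_eq_zero_of_notMem_tsupport fun h => lt_irrefl (0 : ℝ) (hu.2.2 h)
  have hC : Continuous fun t => 2 * u t * deriv u t := by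
    have := hu.1.continuous
    fun_prop
  have hftc : ∫ t in (0 : ℝ)..δ, 2 * u t * deriv u t = u δ ^ 2 := by
    rw [intervalIntegral.integral_eq_sub_of_hasDerivAt (f := u ^ 2)
      (fun t _ => by simpa using (hdiff t).hasDerivAt.pow 2) (hC.intervalIntegrable _ _)]
    simp [hu0]
  simp only [← integral_Ioc_eq_integral_Ioo, ← intervalIntegral.integral_of_le hδ.le]
  rw [← hftc, ← intervalIntegral.integral_add (hA.intervalIntegrable _ _)
    (hB.intervalIntegrable _ _)]
  refine intervalIntegral.integral_mono_on_of_le_Ioo hδ.le (hC.intervalIntegrable _ _)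
    ((hA.add hB).intervalIntegrable _ _) fun t ht => ?_
  have ht0 : 0 < t := ht.1
  have hsq : t * |deriv u t| ^ 2 + t⁻¹ * |u t| ^ 2 - 2 * u t * deriv u t
      = t⁻¹ * (t * deriv u t - u t) ^ 2 := by
    simp only [sq_abs]
    field_simp
    ring
  have : 0 ≤ t⁻¹ * (t * deriv u t - u t) ^ 2 := by positivity
  linarith
end

section
/- Let μ̄ < 0 and m₂ > 0 be real constants. There exists a constant c > 0, depending only on μ̄ and m₂, such that for every real-valued u ∈ C_c^∞((0,∞)) and every t > 0, |u(t)| ≤ c · ‖u‖₂ · t^{−1}, where ‖u‖₂² = ∫₀^∞ ( s|u'(s)|² − μ̄ s^{−1}|u(s)|² + m₂ s³|u(s)|² ) ds. -/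
open Set MeasureTheory

/-- The density of the squared `H₂`-norm is integrable for test functions. -/
lemma IsTestFun.integrable_density {u : ℝ → ℝ} (hu : IsTestFun u) (a b : ℝ) :
    Integrable (fun s : ℝ ↦
      s * |deriv u s| ^ 2 - a * s⁻¹ * |u s| ^ 2 + b * s ^ 3 * |u s| ^ 2) := by
  obtain ⟨hsmooth, hcomp, hsupp⟩ := hu
  have hu' : Continuous (deriv u) := hsmooth.continuous_deriv (by simp)
  have huc : Continuous u := hsmooth.continuous
  have hinv : ContinuousOn (fun s : ℝ ↦ s⁻¹) (tsupport u) :=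
    continuousOn_inv₀.mono fun s hs ↦ (mem_Ioi.mp (hsupp hs)).ne'
  rw [← integrableOn_iff_integrable_of_support_subset (s := tsupport u)]
  · exact ContinuousOn.integrableOn_compact hcomp (by fun_prop)
  · refine Function.support_subset_iff'.mpr fun s hs ↦ ?_
    have h₀ : u s = 0 := image_eq_zero_of_notMem_tsupport hs
    have h₁ : deriv u s = 0 :=
      image_eq_zero_of_notMem_tsupport fun h ↦ hs (tsupport_deriv_subset (𝕜 := ℝ) h)
    simp [h₀, h₁]

/-- The derivative of `s ^ 2 * u s ^ 2`, with `x = u s` and `y = u' s`, is bounded by a multiple of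
the density of the squared `H₂`-norm. -/
lemma deriv_sq_mul_sq_le_density {a b s : ℝ} (ha : a < 0) (hb : 0 < b) (hs : 0 < s) (x y : ℝ) :
    2 * s * x ^ 2 + s ^ 2 * (2 * x * y) ≤
      (1 + (-a)⁻¹ + 2 * b⁻¹) * (s * |y| ^ 2 - a * s⁻¹ * |x| ^ 2 + b * s ^ 3 * |x| ^ 2) := by
  rw [sq_abs, sq_abs]
  have ha' : 0 < -a := neg_pos.mpr ha
  have hP : 0 ≤ s * y ^ 2 := by positivity
  have hQ : 0 ≤ s⁻¹ * x ^ 2 := by positivity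
  have hR : 0 ≤ s ^ 3 * x ^ 2 := by positivity
  have h₁ : s ^ 2 * (2 * x * y) ≤ s * y ^ 2 + s ^ 3 * x ^ 2 := by
    nlinarith [mul_nonneg hs.le (sq_nonneg (y - s * x))]
  have h₂ : 2 * s * x ^ 2 ≤ s⁻¹ * x ^ 2 + s ^ 3 * x ^ 2 := by
    have h : s⁻¹ * x ^ 2 + s ^ 3 * x ^ 2 - 2 * s * x ^ 2 = s⁻¹ * (x * (1 - s ^ 2)) ^ 2 := by
      field_simp
      ring
    have : 0 ≤ s⁻¹ * (x * (1 - s ^ 2)) ^ 2 := by positivity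
    linarith
  calc 2 * s * x ^ 2 + s ^ 2 * (2 * x * y)
      ≤ 1 * (s * y ^ 2) + (-a)⁻¹ * (-a * (s⁻¹ * x ^ 2)) + 2 * b⁻¹ * (b * (s ^ 3 * x ^ 2)) := by
        rw [inv_mul_cancel_left₀ ha'.ne', mul_assoc 2 b⁻¹, inv_mul_cancel_left₀ hb.ne']
        linarith
    _ ≤ (1 + (-a)⁻¹ + 2 * b⁻¹) * (s * y ^ 2) + (1 + (-a)⁻¹ + 2 * b⁻¹) * (-a * (s⁻¹ * x ^ 2)) +
          (1 + (-a)⁻¹ + 2 * b⁻¹) * (b * (s ^ 3 * x ^ 2)) := by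
        have : 0 < (-a)⁻¹ := inv_pos.mpr ha'
        have : 0 < b⁻¹ := inv_pos.mpr hb
        gcongr <;> linarith
    _ = _ := by ring

/-- For `μ̄ < 0`, `m₂ > 0` there is a constant `c > 0`, depending only on `μ̄` and `m₂`,
with `|u(t)| ≤ c‖u‖₂ t⁻¹` for all test functions `u` and all `t > 0`, where
`‖u‖₂² = ∫₀^∞ (s|u'|² − μ̄ s⁻¹|u|² + m₂ s³|u|²) ds`. -/
theorem stmt8 (mubar m₂ : ℝ) (hmubar : mubar < 0) (hm₂ : 0 < m₂) :
    ∃ c > (0 : ℝ), ∀ u : ℝ → ℝ, IsTestFun u → ∀ t > (0 : ℝ),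
      |u t| ≤ c * Real.sqrt (∫ s in Ioi (0 : ℝ),
        (s * |deriv u s| ^ 2 - mubar * s⁻¹ * |u s| ^ 2 + m₂ * s ^ 3 * |u s| ^ 2)) * t⁻¹ := by
  have hC : 0 < 1 + (-mubar)⁻¹ + 2 * m₂⁻¹ := by
    have : 0 < (-mubar)⁻¹ := inv_pos.mpr (neg_pos.mpr hmubar)
    positivity
  refine ⟨√(1 + (-mubar)⁻¹ + 2 * m₂⁻¹), Real.sqrt_pos.mpr hC, fun u hu t ht ↦ ?_⟩
  have hint := hu.integrable_density mubar m₂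
  have hu' : Continuous (deriv u) := hu.1.continuous_deriv (by simp)
  have huc : Continuous u := hu.1.continuous
  have hderiv (s : ℝ) : HasDerivAt (fun s ↦ s ^ 2 * u s ^ 2)
      (2 * s * u s ^ 2 + s ^ 2 * (2 * u s * deriv u s)) s := by
    have hd : HasDerivAt u (deriv u s) s := (hu.1.differentiable (by simp) s).hasDerivAt
    simpa using (hasDerivAt_pow 2 s).fun_mul (hd.fun_pow 2)
  have hcont : Continuous fun s ↦ 2 * s * u s ^ 2 + s ^ 2 * (2 * u s * deriv u s) := by fun_prop
  have hftc := intervalIntegral.integral_eq_sub_of_hasDerivAt (fun s _ ↦ hderiv s)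
    (hcont.intervalIntegrable 0 t)
  rw [intervalIntegral.integral_of_le ht.le] at hftc
  rw [← Real.sqrt_mul hC.le, ← div_eq_mul_inv, le_div_iff₀ ht]
  refine Real.le_sqrt_of_sq_le ?_
  calc (|u t| * t) ^ 2
      = ∫ s in Ioc 0 t, (2 * s * u s ^ 2 + s ^ 2 * (2 * u s * deriv u s)) := by
        rw [hftc, mul_pow, sq_abs]
        ring
    _ ≤ ∫ s in Ioc 0 t, (1 + (-mubar)⁻¹ + 2 * m₂⁻¹) *
          (s * |deriv u s| ^ 2 - mubar * s⁻¹ * |u s| ^ 2 + m₂ * s ^ 3 * |u s| ^ 2) :=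
        setIntegral_mono_on hcont.integrableOn_Ioc (hint.const_mul _).integrableOn
          measurableSet_Ioc fun s hs ↦ deriv_sq_mul_sq_le_density hmubar hm₂ hs.1 _ _
    _ ≤ (1 + (-mubar)⁻¹ + 2 * m₂⁻¹) * ∫ s in Ioi (0 : ℝ),
          (s * |deriv u s| ^ 2 - mubar * s⁻¹ * |u s| ^ 2 + m₂ * s ^ 3 * |u s| ^ 2) := by
        rw [integral_const_mul]
        refine mul_le_mul_of_nonneg_left ?_ hC.le
        refine setIntegral_mono_set hint.integrableOn ?_ Ioc_subset_Ioi_self.eventuallyLE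
        refine (ae_restrict_iff' measurableSet_Ioi).mpr (.of_forall fun s (hs : 0 < s) ↦ ?_)
        have : 0 ≤ -mubar * s⁻¹ * |u s| ^ 2 :=
          mul_nonneg (mul_nonneg (neg_pos.mpr hmubar).le (inv_pos.mpr hs).le) (sq_nonneg _)
        have : 0 ≤ s * |deriv u s| ^ 2 + m₂ * s ^ 3 * |u s| ^ 2 := by positivity
        simp only [Pi.zero_apply]
        linarith
end

section
/- Let n ≥ 3 be a natural number and let μ̄ < 0, m₁ > 0, m₂ > 0, λ > 0 be real constants, and let t₀ > 0 satisfy λ m₁ t₀^{4−4/n} < −μ̄. Suppose u : (0,t₀] → ℝ is C², satisfies u(t₀) = 0, solves −(t u'(t))' − μ̄ t^{−1} u(t) + m₂ t³ u(t) = λ m₁ t^{3−4/n} u(t) for all t ∈ (0,t₀), has finite energy ∫₀^{t₀} ( t|u'(t)|² + t^{−1}|u(t)|² ) dt < ∞, and satisfies liminf_{t→0⁺} |t u'(t) u(t)| = 0. Then u is identically zero on (0,t₀]. (This is the key step showing that the eigenspaces of the variational eigenvalue problem B̃(u,v) = λ K(u,v) are one-dimensional.) -/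
open Set MeasureTheory Filter Topology

/-- The reciprocal is not integrable near `0`. -/
theorem not_integrableOn_Ioo_zero_inv {a : ℝ} (ha : 0 < a) :
    ¬ IntegrableOn (fun t : ℝ => t⁻¹) (Ioo 0 a) := by
  intro h
  have h' : IntervalIntegrable (fun t : ℝ => t⁻¹) volume 0 a :=
    (intervalIntegrable_iff_integrableOn_Ioo_of_le ha.le).2 h
  rcases intervalIntegrable_inv_iff.1 h' with h0 | h0
  · exact ha.ne h0
  · exact h0 left_mem_uIcc

/-- If `u` is `C²` on `(0,a]` with `u a = 0` and `(t u')' u ≥ 0` on `(0,a)`, then `u²` is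
nonincreasing on `(0,a]`. -/
theorem antitoneOn_sq_of_deriv_mul_self_nonneg {a : ℝ} {u : ℝ → ℝ} (ha : 0 < a)
    (hu : ContDiffOn ℝ 2 u (Ioc 0 a)) (hbc : u a = 0)
    (hq : ∀ t ∈ Ioo (0 : ℝ) a, 0 ≤ deriv (fun s => s * deriv u s) t * u t) :
    AntitoneOn (fun t => u t ^ 2) (Ioc 0 a) := by
  have hint : interior (Ioc 0 a) = Ioo 0 a := interior_Ioc
  have huo : ContDiffOn ℝ 2 u (Ioo 0 a) := hu.mono Ioo_subset_Ioc_self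
  have hdu : ∀ t ∈ Ioo (0 : ℝ) a, DifferentiableAt ℝ u t := fun t ht =>
    (huo.differentiableOn (by norm_num)).differentiableAt (isOpen_Ioo.mem_nhds ht)
  have hddu : ∀ t ∈ Ioo (0 : ℝ) a, DifferentiableAt ℝ (deriv u) t := fun t ht =>
    ((huo.deriv_of_isOpen (m := 1) isOpen_Ioo (by norm_num)).differentiableOn
      (by norm_num)).differentiableAt (isOpen_Ioo.mem_nhds ht)
  have heq : ∀ t ∈ Ioo (0 : ℝ) a, derivWithin u (Ioc 0 a) t = deriv u t := fun t ht =>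
    derivWithin_of_mem_nhds (Ioc_mem_nhds ht.1 ht.2)
  set W : ℝ → ℝ := fun t => t * derivWithin u (Ioc 0 a) t * u t with hW
  have hWc : ContinuousOn W (Ioc 0 a) :=
    (continuousOn_id.mul (hu.continuousOn_derivWithin (uniqueDiffOn_Ioc 0 a)
      (by norm_num))).mul hu.continuousOn
  have hWd : ∀ t ∈ Ioo (0 : ℝ) a, HasDerivAt W
      (deriv (fun s => s * deriv u s) t * u t + t * deriv u t * deriv u t) t := by
    intro t ht
    have h1 : DifferentiableAt ℝ (fun s => s * deriv u s) t :=
      differentiableAt_id.mul (hddu t ht)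
    refine (h1.hasDerivAt.mul (hdu t ht).hasDerivAt).congr_of_eventuallyEq ?_
    filter_upwards [isOpen_Ioo.mem_nhds ht] with s hs
    simp only [hW, Pi.mul_apply, heq s hs]
  have hWm : MonotoneOn W (Ioc 0 a) := by
    refine monotoneOn_of_deriv_nonneg (convex_Ioc 0 a) hWc ?_ ?_ <;> rw [hint]
    · exact fun t ht => (hWd t ht).differentiableAt.differentiableWithinAt
    · intro t ht
      rw [(hWd t ht).deriv, mul_assoc]
      exact add_nonneg (hq t ht) (mul_nonneg ht.1.le (mul_self_nonneg _))
  refine antitoneOn_of_deriv_nonpos (convex_Ioc 0 a) (hu.continuousOn.pow 2) ?_ ?_ <;> rw [hint]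
  · exact fun t ht => ((hdu t ht).pow 2).differentiableWithinAt
  · intro t ht
    have hWt : W t ≤ W a := hWm ⟨ht.1, ht.2.le⟩ ⟨ha, le_rfl⟩ ht.2.le
    simp only [hW, hbc, mul_zero, heq t ht, mul_assoc] at hWt
    have h0 : deriv u t * u t ≤ 0 := nonpos_of_mul_nonpos_right hWt ht.1
    rw [((hdu t ht).hasDerivAt.fun_pow 2).deriv]
    norm_num
    linarith

/-- Uniqueness step for one-dimensionality of the eigenspaces: if
`λ m₁ t₀^{4−4/n} < −μ̄` and `u` is a `C²` finite-energy solution on `(0,t₀]` of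
`−(t u')' − μ̄ t⁻¹ u + m₂ t³ u = λ m₁ t^{3−4/n} u` with `u(t₀) = 0` and
`liminf_{t→0⁺} |t u' u| = 0`, then `u ≡ 0` on `(0,t₀]`. -/
theorem stmt10 (n : ℕ) (hn : 3 ≤ n) (mubar m₁ m₂ lam t₀ : ℝ)
    (hmubar : mubar < 0) (hm₁ : 0 < m₁) (hm₂ : 0 < m₂) (hlam : 0 < lam) (ht₀ : 0 < t₀)
    (hsmall : lam * m₁ * t₀ ^ (4 - 4 / (n : ℝ)) < -mubar)
    (u : ℝ → ℝ) (hu : ContDiffOn ℝ 2 u (Ioc 0 t₀))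
    (hbc : u t₀ = 0)
    (hode : ∀ t ∈ Ioo (0 : ℝ) t₀,
      -(deriv (fun s => s * deriv u s) t) - mubar * t⁻¹ * u t + m₂ * t ^ 3 * u t
        = lam * m₁ * t ^ (3 - 4 / (n : ℝ)) * u t)
    (henergy : IntegrableOn (fun t => t * |deriv u t| ^ 2 + t⁻¹ * |u t| ^ 2) (Ioo 0 t₀))
    (hliminf : liminf (fun t => |t * deriv u t * u t|) (nhdsWithin 0 (Ioi 0)) = 0) :
    ∀ t ∈ Ioc (0 : ℝ) t₀, u t = 0 := by
  have hexp : 0 ≤ 4 - 4 / (n : ℝ) := by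
    have hn' : (3 : ℝ) ≤ n := by exact_mod_cast hn
    have : 4 / (n : ℝ) ≤ 4 := div_le_self (by norm_num) (by linarith)
    linarith
  have hq : ∀ t ∈ Ioo (0 : ℝ) t₀, 0 ≤ deriv (fun s => s * deriv u s) t * u t := by
    intro t ht
    have ht0 := ht.1
    have hpow : t ^ (3 - 4 / (n : ℝ)) = t ^ (4 - 4 / (n : ℝ)) * t⁻¹ := by
      rw [← Real.rpow_neg_one, ← Real.rpow_add ht0]
      ring_nf
    have hle : lam * m₁ * t ^ (4 - 4 / (n : ℝ)) ≤ lam * m₁ * t₀ ^ (4 - 4 / (n : ℝ)) := by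
      gcongr
      exact ht.2.le
    have hcoef : 0 ≤ (-mubar - lam * m₁ * t ^ (4 - 4 / (n : ℝ))) * t⁻¹ + m₂ * t ^ 3 :=
      add_nonneg (mul_nonneg (by linarith) (by positivity)) (by positivity)
    have hode_t := hode t ht
    rw [hpow] at hode_t
    have hd : deriv (fun s => s * deriv u s) t
        = ((-mubar - lam * m₁ * t ^ (4 - 4 / (n : ℝ))) * t⁻¹ + m₂ * t ^ 3) * u t := by
      linear_combination -hode_t
    rw [hd, mul_assoc]
    exact mul_nonneg hcoef (mul_self_nonneg _)
  have hanti := antitoneOn_sq_of_deriv_mul_self_nonneg ht₀ hu hbc hq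
  intro t ht
  by_contra hut
  refine not_integrableOn_Ioo_zero_inv ht.1 ?_
  have hen : IntegrableOn (fun s => (u t ^ 2)⁻¹ * (s * |deriv u s| ^ 2 + s⁻¹ * |u s| ^ 2))
      (Ioo 0 t) := (henergy.mono_set (Ioo_subset_Ioo_right ht.2)).const_mul _
  refine Integrable.mono' hen measurable_inv.aestronglyMeasurable ?_
  filter_upwards [ae_restrict_mem measurableSet_Ioo] with s hs
  have hs0 := hs.1
  have hsq : u t ^ 2 ≤ u s ^ 2 := hanti ⟨hs0, hs.2.le.trans ht.2⟩ ht hs.2.le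
  have hpos : 0 < u t ^ 2 := by positivity
  rw [Real.norm_of_nonneg (inv_nonneg.2 hs0.le), le_inv_mul_iff₀ hpos, sq_abs (u s),
    mul_comm (u t ^ 2)]
  exact (mul_le_mul_of_nonneg_left hsq (inv_nonneg.2 hs0.le)).trans
    (le_add_of_nonneg_left (by positivity))
end

section
/- Let E be a complex Hilbert space and let A be a densely defined linear operator on E (a linear partial map with dense domain) which is symmetric, i.e. ⟪A u, v⟫ = ⟪u, A v⟫ for all u, v in the domain of A, and bounded below by a positive constant: there is λ₀ > 0 such that re ⟪A u, u⟫ ≥ λ₀ ‖u‖² for all u in the domain of A. If the range of A is dense in E, then A is closable and its closure Ā is surjective, i.e. the range of Ā is all of E. -/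
open scoped ComplexInnerProductSpace

/-- A densely defined symmetric operator is closable. -/
theorem LinearPMap.isClosable_of_isFormalAdjoint_self {𝕜 E : Type*} [RCLike 𝕜]
    [NormedAddCommGroup E] [InnerProductSpace 𝕜 E] [CompleteSpace E] {A : E →ₗ.[𝕜] E}
    (hdense : Dense (A.domain : Set E)) (hA : A.IsFormalAdjoint A) : A.IsClosable :=
  (LinearPMap.adjoint_isClosed hdense).isClosable.leIsClosable (hA.le_adjoint hdense)

/-- If a closable operator into a complete space is bounded below in norm and has dense range,
then its closure is surjective. -/
theorem LinearPMap.IsClosable.closure_surjective {𝕜 E F : Type*} [NontriviallyNormedField 𝕜]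
    [NormedAddCommGroup E] [NormedSpace 𝕜 E] [CompleteSpace E]
    [NormedAddCommGroup F] [NormedSpace 𝕜 F] {A : E →ₗ.[𝕜] F} (hA : A.IsClosable)
    {c : ℝ} (hc : 0 < c) (hbound : ∀ u : A.domain, c * ‖(u : E)‖ ≤ ‖A u‖)
    (hrange : DenseRange fun u : A.domain => A u) (y : F) :
    ∃ u : A.closure.domain, A.closure u = y := by
  obtain ⟨z, hz, hzy⟩ := mem_closure_iff_seq_limit.1 (hrange y)
  choose u hu using hz
  have hcauchy : CauchySeq fun n => (u n : E) := by
    rw [Metric.cauchySeq_iff]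
    intro ε hε
    obtain ⟨N, hN⟩ := Metric.cauchySeq_iff.1 hzy.cauchySeq (c * ε) (by positivity)
    refine ⟨N, fun m hm n hn => ?_⟩
    have hlt := hN m hm n hn
    have hle := hbound (u m - u n)
    rw [A.map_sub] at hle
    rw [dist_eq_norm, ← hu m, ← hu n] at hlt
    rw [dist_eq_norm]
    exact lt_of_mul_lt_mul_left (hle.trans_lt hlt) hc.le
  obtain ⟨x, hx⟩ := cauchySeq_tendsto_of_complete hcauchy
  have hxy : (x, y) ∈ A.closure.graph := by
    rw [← hA.graph_closure_eq_closure_graph]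
    refine mem_closure_of_tendsto (hx.prodMk_nhds hzy) (Filter.Eventually.of_forall fun n => ?_)
    rw [← hu n]
    exact A.mem_graph (u n)
  obtain ⟨v, -, hv⟩ := A.closure.mem_graph_iff.1 hxy
  exact ⟨v, hv⟩

/-- A densely defined symmetric operator on a complex Hilbert space which is bounded
below by a positive constant and has dense range is closable, and its closure is
surjective. -/
theorem stmt11 {E : Type*} [NormedAddCommGroup E] [InnerProductSpace ℂ E] [CompleteSpace E]
    (A : E →ₗ.[ℂ] E) (hdense : Dense (A.domain : Set E))
    (hsymm : ∀ u v : A.domain, ⟪A u, (v : E)⟫ = ⟪(u : E), A v⟫)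
    (lam₀ : ℝ) (hlam₀ : 0 < lam₀)
    (hbound : ∀ u : A.domain, lam₀ * ‖(u : E)‖ ^ 2 ≤ (⟪A u, (u : E)⟫).re)
    (hrange : Dense (Set.range fun u : A.domain => A u)) :
    A.IsClosable ∧ ∀ y : E, ∃ u : A.closure.domain, A.closure u = y := by
  have hclosable := LinearPMap.isClosable_of_isFormalAdjoint_self hdense hsymm
  refine ⟨hclosable, hclosable.closure_surjective hlam₀ (fun u => ?_) hrange⟩
  rcases (norm_nonneg (u : E)).eq_or_lt with h | h
  · simp [← h]
  · refine le_of_mul_le_mul_right ?_ h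
    calc lam₀ * ‖(u : E)‖ * ‖(u : E)‖ = lam₀ * ‖(u : E)‖ ^ 2 := by ring
      _ ≤ (⟪A u, (u : E)⟫).re := hbound u
      _ ≤ ‖A u‖ * ‖(u : E)‖ := re_inner_le_norm (𝕜 := ℂ) _ _
end

section
/- Let n ≥ 3 be a natural number, m, μ₀ real constants, m₁ > 0, m₂ > 0, and Λ < 0. Let B̂ denote the operator (B̂w)(t) = −t^{−m}(t^m w'(t))' − μ₀ t^{−2} w(t). If a C² function w̄ : (0,∞) → ℝ satisfies the eigenvalue equation for cosmological constant Λ = −1 with eigenvalue λ̄ > 0, namely B̂w̄ + m₂ t² w̄ = λ̄ m₁ t^{2−4/n} w̄ on (0,∞), then the rescaled function w(t) = w̄(|Λ|^{1/4} t) satisfies B̂w + m₂ |Λ| t² w = λ m₁ t^{2−4/n} w on (0,∞) with eigenvalue λ = λ̄ · |Λ|^{(n−1)/n}. Hence the temporal eigenvalues for cosmological constant Λ < 0 are obtained from those for Λ = −1 by the scaling λ_i = λ̄_i |Λ|^{(n−1)/n}. -/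
open Set

/-- The Bessel-type operator `B̂w = −t^{−m}(t^m w')' − μ₀ t^{−2} w` on `(0,∞)`. -/
noncomputable def Bhat (m μ₀ : ℝ) (w : ℝ → ℝ) (t : ℝ) : ℝ :=
  -t ^ (-m) * deriv (fun s : ℝ => s ^ m * deriv w s) t - μ₀ * (t ^ 2)⁻¹ * w t

/-- The operator `Bhat` is homogeneous of degree two under dilations. -/
theorem Bhat_comp_mul_left (m μ₀ : ℝ) (w : ℝ → ℝ) {c t : ℝ} (hc : 0 < c) (ht : 0 < t) :
    Bhat m μ₀ (fun s => w (c * s)) t = c ^ 2 * Bhat m μ₀ w (c * t) := by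
  have hcm : c ^ m ≠ 0 := (Real.rpow_pos_of_pos hc m).ne'
  have hd : deriv (fun s : ℝ => s ^ m * deriv (fun x => w (c * x)) s) t =
      c * (c ^ m)⁻¹ * (c * deriv (fun u : ℝ => u ^ m * deriv w u) (c * t)) := by
    have hev : (fun s : ℝ => s ^ m * deriv (fun x => w (c * x)) s) =ᶠ[nhds t]
        fun s => c * (c ^ m)⁻¹ * (fun u : ℝ => u ^ m * deriv w u) (c * s) := by
      filter_upwards [Ioi_mem_nhds ht] with s hs
      rw [deriv_comp_mul_left, smul_eq_mul, Real.mul_rpow hc.le (le_of_lt hs)]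
      field_simp
    rw [hev.deriv_eq, deriv_const_mul_field,
      deriv_comp_mul_left c (fun u : ℝ => u ^ m * deriv w u), smul_eq_mul]
  unfold Bhat
  rw [hd, Real.mul_rpow hc.le ht.le, Real.rpow_neg hc.le]
  field_simp

/-- Scaling of the temporal eigenvalues with the cosmological constant: if `w̄` solves
the eigenvalue equation for `Λ = −1` with eigenvalue `λ̄ > 0`, i.e.
`B̂w̄ + m₂ t² w̄ = λ̄ m₁ t^{2−4/n} w̄`, then `w(t) = w̄(|Λ|^{1/4} t)` solves
`B̂w + m₂ |Λ| t² w = λ m₁ t^{2−4/n} w` with `λ = λ̄ |Λ|^{(n−1)/n}`. -/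
theorem stmt13 (n : ℕ) (hn : 3 ≤ n) (m μ₀ m₁ m₂ Λ lambar : ℝ)
    (hm₁ : 0 < m₁) (hm₂ : 0 < m₂) (hΛ : Λ < 0) (hlambar : 0 < lambar)
    (wbar : ℝ → ℝ) (hwbar : ContDiffOn ℝ 2 wbar (Ioi 0))
    (heq : ∀ t ∈ Ioi (0 : ℝ),
      Bhat m μ₀ wbar t + m₂ * t ^ 2 * wbar t = lambar * m₁ * t ^ (2 - 4 / (n : ℝ)) * wbar t) :
    ∀ t ∈ Ioi (0 : ℝ),
      Bhat m μ₀ (fun s => wbar (|Λ| ^ ((1 : ℝ) / 4) * s)) t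
          + m₂ * |Λ| * t ^ 2 * wbar (|Λ| ^ ((1 : ℝ) / 4) * t)
        = (lambar * |Λ| ^ (((n : ℝ) - 1) / (n : ℝ))) * m₁ * t ^ (2 - 4 / (n : ℝ)) *
            wbar (|Λ| ^ ((1 : ℝ) / 4) * t) := by
  intro t ht
  have ht' : 0 < t := ht
  have hL : 0 < |Λ| := abs_pos.mpr hΛ.ne
  have hc : 0 < |Λ| ^ ((1 : ℝ) / 4) := Real.rpow_pos_of_pos hL _
  have hn0 : (n : ℝ) ≠ 0 := by
    have : n ≠ 0 := by omega
    exact_mod_cast this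
  have hc4 : (|Λ| ^ ((1 : ℝ) / 4)) ^ 4 = |Λ| := by
    rw [← Real.rpow_natCast, ← Real.rpow_mul hL.le]
    norm_num
  have hpow : |Λ| ^ (((n : ℝ) - 1) / (n : ℝ)) =
      (|Λ| ^ ((1 : ℝ) / 4)) ^ 2 * (|Λ| ^ ((1 : ℝ) / 4)) ^ (2 - 4 / (n : ℝ)) := by
    rw [← Real.rpow_natCast, ← Real.rpow_add hc, ← Real.rpow_mul hL.le]
    congr 1
    push_cast
    field_simp
    ring
  have h := heq _ (mem_Ioi.mpr (mul_pos hc ht'))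
  rw [Bhat_comp_mul_left m μ₀ wbar hc ht', hpow]
  rw [Real.mul_rpow hc.le ht'.le] at h
  generalize |Λ| ^ ((1 : ℝ) / 4) = c at *
  rw [← hc4]
  linear_combination c ^ 2 * h
end

section
/- Let n ≥ 3 be a natural number and let μ̄ < 0, m₂' > 0, c₁ > 0 be real constants, and define ‖u‖₂² = ∫₀^∞ ( t|u'(t)|² − μ̄ t^{−1}|u(t)|² + m₂' t³|u(t)|² ) dt and ‖u‖₀² = ∫₀^∞ (1+t)^{−2} |u(t)|² dt. Then there exist constants c > 0 and γ > 0, depending only on n, μ̄, m₂', c₁, such that every λ > 0 and every C¹ function u : (0,∞) → ℝ with ‖u‖₂ < ∞ satisfying the eigenfunction-type estimate ‖u‖₂² ≤ c₁ λ ∫₀^∞ t^{3−4/n} |u(t)|² dt obeys ‖u‖₂ ≤ c (1+λ)^γ ‖u‖₀. -/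
open Set MeasureTheory

/-- The weight `t ^ (3 - 4 / n)` is absorbed by a small multiple of `t ^ 3` for large `t` and by
the weight `(1 + t)⁻²`, with a constant polynomial in `lam`, for the remaining `t`. -/
lemma rpow_weight_le (n : ℕ) (hn : 3 ≤ n) {m c lam t : ℝ} (hm : 0 < m) (hc : 0 < c)
    (hlam : 0 < lam) (ht : 0 < t) :
    c * lam * t ^ (3 - 4 / (n : ℝ)) ≤ m / 2 * t ^ 3 +
      4 * c * (1 + lam) * (((1 + 2 * c / m) * (1 + lam)) ^ ((n : ℝ) / 4)) ^ 5 *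
        ((1 + t) ^ 2)⁻¹ := by
  have hn' : (3 : ℝ) ≤ n := by exact_mod_cast hn
  have hcm : 0 < 2 * c / m := by positivity
  set b : ℝ := (1 + 2 * c / m) * (1 + lam) with hb
  have hb1 : 1 ≤ b := by nlinarith [mul_pos hcm hlam]
  set T : ℝ := b ^ ((n : ℝ) / 4) with hT
  have hT1 : 1 ≤ T := Real.one_le_rpow hb1 (by positivity)
  rcases le_total t T with h | h
  · have hexp : 4 / (n : ℝ) ≤ 3 := by
      rw [div_le_iff₀ (by linarith)]; linarith
    have hpow : t ^ (3 - 4 / (n : ℝ)) ≤ T ^ 3 := calc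
      t ^ (3 - 4 / (n : ℝ)) ≤ T ^ (3 - 4 / (n : ℝ)) :=
        Real.rpow_le_rpow ht.le h (by linarith)
      _ ≤ T ^ (3 : ℝ) := Real.rpow_le_rpow_of_exponent_le hT1 (by
        have : 0 < 4 / (n : ℝ) := by positivity
        linarith)
      _ = T ^ 3 := by norm_cast
    have hsq : (1 + t) ^ 2 ≤ 4 * T ^ 2 := by nlinarith
    have hmul : t ^ (3 - 4 / (n : ℝ)) * (1 + t) ^ 2 ≤ 4 * T ^ 5 := calc
      _ ≤ T ^ 3 * (4 * T ^ 2) := by gcongr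
      _ = 4 * T ^ 5 := by ring
    have hle : c * lam * t ^ (3 - 4 / (n : ℝ)) ≤
        4 * c * (1 + lam) * T ^ 5 * ((1 + t) ^ 2)⁻¹ := by
      rw [← div_eq_mul_inv, le_div_iff₀ (by positivity)]
      calc c * lam * t ^ (3 - 4 / (n : ℝ)) * (1 + t) ^ 2
          = c * lam * (t ^ (3 - 4 / (n : ℝ)) * (1 + t) ^ 2) := by ring
        _ ≤ c * (1 + lam) * (4 * T ^ 5) := by gcongr; linarith
        _ = 4 * c * (1 + lam) * T ^ 5 := by ring
    have : 0 ≤ m / 2 * t ^ 3 := by positivity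
    linarith
  · have hbt : b ≤ t ^ (4 / (n : ℝ)) := calc
      b = T ^ (4 / (n : ℝ)) := by
        rw [hT, ← Real.rpow_mul (by linarith)]
        have : (n : ℝ) / 4 * (4 / n) = 1 := by field_simp
        rw [this, Real.rpow_one]
      _ ≤ t ^ (4 / (n : ℝ)) := Real.rpow_le_rpow (by linarith) h (by positivity)
    have hcl : c * lam ≤ m / 2 * b := by
      have hid : m / 2 * b = (m / 2 + c) * (1 + lam) := by rw [hb]; field_simp
      rw [hid]
      nlinarith [mul_pos hm hlam]
    have hle : c * lam * t ^ (3 - 4 / (n : ℝ)) ≤ m / 2 * t ^ 3 := by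
      rw [Real.rpow_sub ht, ← mul_div_assoc, div_le_iff₀ (by positivity)]
      calc c * lam * t ^ (3 : ℝ) ≤ m / 2 * t ^ (4 / (n : ℝ)) * t ^ (3 : ℝ) :=
            mul_le_mul_of_nonneg_right (hcl.trans (by gcongr)) (by positivity)
        _ = m / 2 * t ^ 3 * t ^ (4 / (n : ℝ)) := by norm_cast; ring
    have : 0 ≤ 4 * c * (1 + lam) * T ^ 5 * ((1 + t) ^ 2)⁻¹ := by positivity
    linarith

/-- Lemma 6.3-type estimate: for `n ≥ 3`, `μ̄ < 0`, `m₂' > 0`, `c₁ > 0` there are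
constants `c > 0` and `γ > 0` such that every `λ > 0` and every `C¹` function `u` on
`(0,∞)` with finite `H₂`-norm satisfying
`‖u‖₂² ≤ c₁ λ ∫₀^∞ t^{3−4/n} |u|² dt` obeys `‖u‖₂ ≤ c (1+λ)^γ ‖u‖₀`,
where `‖u‖₂² = ∫₀^∞ (t|u'|² − μ̄ t⁻¹|u|² + m₂' t³|u|²) dt` and
`‖u‖₀² = ∫₀^∞ (1+t)⁻²|u|² dt`. -/
theorem stmt15 (n : ℕ) (hn : 3 ≤ n) (mubar m₂' c₁ : ℝ)
    (hmubar : mubar < 0) (hm₂' : 0 < m₂') (hc₁ : 0 < c₁) :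
    ∃ c > (0 : ℝ), ∃ γ > (0 : ℝ), ∀ lam > (0 : ℝ), ∀ u : ℝ → ℝ,
      ContDiffOn ℝ 1 u (Ioi 0) →
      IntegrableOn
        (fun t => t * |deriv u t| ^ 2 - mubar * t⁻¹ * |u t| ^ 2 + m₂' * t ^ 3 * |u t| ^ 2)
        (Ioi 0) →
      (∫ t in Ioi (0 : ℝ),
          (t * |deriv u t| ^ 2 - mubar * t⁻¹ * |u t| ^ 2 + m₂' * t ^ 3 * |u t| ^ 2))
        ≤ c₁ * lam * ∫ t in Ioi (0 : ℝ), t ^ (3 - 4 / (n : ℝ)) * |u t| ^ 2 →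
      Real.sqrt (∫ t in Ioi (0 : ℝ),
          (t * |deriv u t| ^ 2 - mubar * t⁻¹ * |u t| ^ 2 + m₂' * t ^ 3 * |u t| ^ 2))
        ≤ c * (1 + lam) ^ γ *
            Real.sqrt (∫ t in Ioi (0 : ℝ), ((1 + t) ^ 2)⁻¹ * |u t| ^ 2) := by
  have ha : 0 < 1 + 2 * c₁ / m₂' := by positivity
  refine ⟨Real.sqrt (8 * c₁ * ((1 + 2 * c₁ / m₂') ^ ((n : ℝ) / 4)) ^ 5), by positivity,
    (1 + (n : ℝ) / 4 * 5) / 2, by positivity, ?_⟩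
  intro lam hlam u hu hint hle
  set F : ℝ → ℝ := fun t =>
    t * |deriv u t| ^ 2 - mubar * t⁻¹ * |u t| ^ 2 + m₂' * t ^ 3 * |u t| ^ 2 with hF
  set G : ℝ → ℝ := fun t => ((1 + t) ^ 2)⁻¹ * |u t| ^ 2 with hG
  set K : ℝ := 4 * c₁ * (1 + lam) *
    (((1 + 2 * c₁ / m₂') * (1 + lam)) ^ ((n : ℝ) / 4)) ^ 5 with hK
  have hFu : ∀ t ∈ Ioi (0 : ℝ), -mubar * (t⁻¹ * |u t| ^ 2) + m₂' * t ^ 3 * |u t| ^ 2 ≤ F t := by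
    intro t ht
    have : 0 ≤ t * |deriv u t| ^ 2 := mul_nonneg (mem_Ioi.1 ht).le (by positivity)
    simp only [hF]
    linarith
  have hGint : IntegrableOn G (Ioi 0) := by
    refine Integrable.mono' (hint.const_mul (-mubar)⁻¹) ?_ ?_
    · refine ContinuousOn.aestronglyMeasurable ?_ measurableSet_Ioi
      refine ContinuousOn.mul (ContinuousOn.inv₀ (by fun_prop) ?_) (hu.continuousOn.abs.pow 2)
      intro t ht
      have : 0 < t := ht
      positivity
    · filter_upwards [ae_restrict_mem measurableSet_Ioi] with t ht
      have ht' : 0 < t := ht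
      have hGt : G t ≤ t⁻¹ * |u t| ^ 2 := by
        simp only [hG]
        gcongr
        nlinarith
      rw [Real.norm_of_nonneg (by positivity), ← div_eq_inv_mul, le_div_iff₀ (by linarith)]
      have h3 : 0 ≤ m₂' * t ^ 3 * |u t| ^ 2 := by positivity
      nlinarith [hFu t ht, mul_le_mul_of_nonneg_left hGt (neg_pos.2 hmubar).le]
  have hmain : c₁ * lam * ∫ t in Ioi (0 : ℝ), t ^ (3 - 4 / (n : ℝ)) * |u t| ^ 2 ≤
      1 / 2 * (∫ t in Ioi (0 : ℝ), F t) + K * ∫ t in Ioi (0 : ℝ), G t := by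
    rw [← integral_const_mul, ← integral_const_mul, ← integral_const_mul,
      ← integral_add (hint.const_mul _) (hGint.const_mul _)]
    refine integral_mono_of_nonneg ?_ ((hint.const_mul _).add (hGint.const_mul _)) ?_
    · filter_upwards [ae_restrict_mem measurableSet_Ioi] with t ht
      have ht' : 0 < t := ht
      simp only [Pi.zero_apply]
      positivity
    · filter_upwards [ae_restrict_mem measurableSet_Ioi] with t ht
      have ht' : 0 < t := ht
      have hw := mul_le_mul_of_nonneg_right (rpow_weight_le n hn hm₂' hc₁ hlam ht')
        (sq_nonneg |u t|)
      have hμ : 0 ≤ -mubar * (t⁻¹ * |u t| ^ 2) :=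
        mul_nonneg (by linarith) (by positivity)
      have hFt := hFu t ht
      calc c₁ * lam * (t ^ (3 - 4 / (n : ℝ)) * |u t| ^ 2)
          = c₁ * lam * t ^ (3 - 4 / (n : ℝ)) * |u t| ^ 2 := by ring
        _ ≤ (m₂' / 2 * t ^ 3 + K * ((1 + t) ^ 2)⁻¹) * |u t| ^ 2 := hw
        _ = 1 / 2 * (m₂' * t ^ 3 * |u t| ^ 2) + K * G t := by simp only [hG]; ring
        _ ≤ 1 / 2 * F t + K * G t := by linarith
  have habs : (∫ t in Ioi (0 : ℝ), F t) ≤ 2 * K * ∫ t in Ioi (0 : ℝ), G t := by linarith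
  have hconst : 2 * K = 8 * c₁ * ((1 + 2 * c₁ / m₂') ^ ((n : ℝ) / 4)) ^ 5 *
      ((1 + lam) ^ ((1 + (n : ℝ) / 4 * 5) / 2)) ^ 2 := by
    have h1 : 0 < 1 + lam := by linarith
    have hγ : ((1 + lam) ^ ((1 + (n : ℝ) / 4 * 5) / 2)) ^ 2 =
        (1 + lam) * ((1 + lam) ^ ((n : ℝ) / 4)) ^ 5 := by
      rw [← Real.rpow_mul_natCast h1.le, ← Real.rpow_mul_natCast h1.le]
      have : (1 + (n : ℝ) / 4 * 5) / 2 * (2 : ℕ) = 1 + (n : ℝ) / 4 * (5 : ℕ) := by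
        push_cast; ring
      rw [this, Real.rpow_add h1, Real.rpow_one]
    rw [hγ, hK, Real.mul_rpow ha.le h1.le]
    ring
  calc Real.sqrt (∫ t in Ioi (0 : ℝ), F t)
      ≤ Real.sqrt (2 * K * ∫ t in Ioi (0 : ℝ), G t) := Real.sqrt_le_sqrt habs
    _ = _ := by
      rw [hconst, Real.sqrt_mul (by positivity), Real.sqrt_mul (by positivity),
        Real.sqrt_sq (by positivity)]
end

section
/- Let n ≥ 3 be a natural number and let μ̄ < 0, m₂' > 0, c₁ ≥ c₂ > 0, λ₀ > 0, β > 0 be real constants, and define ⟨u,v⟩₂ = ∫₀^∞ ( t u'v' − μ̄ t^{−1} uv + m₂' t³ uv ) dt with norm ‖u‖₂ = ⟨u,u⟩₂^{1/2}. Suppose (u_i)_{i∈ℕ} are C¹ functions on (0,∞) with 0 < ‖u_i‖₂ < ∞ such that: (i) the normalized functions ũ_i = u_i/‖u_i‖₂ form an orthonormal family with respect to ⟨·,·⟩₂; (ii) ∫₀^∞ t^{3−4/n} |u_i(t)|² dt = 1 for every i; and (iii) there are real numbers λ_i ≥ λ₀ with c₂ λ_i ≤ ‖u_i‖₂² ≤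 c₁ λ_i for every i. Then ∑_{i=0}^∞ e^{−β λ_i} < ∞. (This is the trace-class property of e^{−βH₀} for the temporal Hamiltonian H₀ with eigenvalues λ_i and eigenfunctions u_i.) -/
open Set MeasureTheory

/-- The integrand of the bilinear form `⟨f, g⟩₂ = ∫₀^∞ (t f' g' − m t⁻¹ f g + b t³ f g) dt`. -/
noncomputable def energyDensity (m b : ℝ) (f g : ℝ → ℝ) (t : ℝ) : ℝ :=
  t * deriv f t * deriv g t - m * t⁻¹ * f t * g t + b * t ^ 3 * f t * g t

lemma energyDensity_self (m b : ℝ) (f : ℝ → ℝ) (t : ℝ) :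
    energyDensity m b f f t
      = t * |deriv f t| ^ 2 - m * t⁻¹ * |f t| ^ 2 + b * t ^ 3 * |f t| ^ 2 := by
  simp only [energyDensity, sq_abs]
  ring

section Pointwise

variable {m b : ℝ} {f g : ℝ → ℝ} {t : ℝ}

lemma mul_deriv_sq_le_energyDensity (hm : m < 0) (hb : 0 < b) (ht : 0 < t) :
    t * deriv f t ^ 2 ≤ energyDensity m b f f t := by
  have h1 : 0 ≤ -m * (t⁻¹ * f t ^ 2) := mul_nonneg (by linarith) (by positivity)
  have h2 : 0 ≤ b * t ^ 3 * f t ^ 2 := by positivity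
  unfold energyDensity
  linarith

lemma inv_mul_sq_le_energyDensity (hb : 0 < b) (ht : 0 < t) :
    -m * (t⁻¹ * f t ^ 2) ≤ energyDensity m b f f t := by
  have h1 : 0 ≤ t * deriv f t ^ 2 := by positivity
  have h2 : 0 ≤ b * t ^ 3 * f t ^ 2 := by positivity
  unfold energyDensity
  linarith

lemma cube_mul_sq_le_energyDensity (hm : m < 0) (ht : 0 < t) :
    b * (t ^ 3 * f t ^ 2) ≤ energyDensity m b f f t := by
  have h1 : 0 ≤ t * deriv f t ^ 2 := by positivity
  have h2 : 0 ≤ -m * (t⁻¹ * f t ^ 2) := mul_nonneg (by linarith) (by positivity)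
  unfold energyDensity
  linarith

lemma energyDensity_self_nonneg (hm : m < 0) (hb : 0 < b) (ht : 0 < t) :
    0 ≤ energyDensity m b f f t :=
  le_trans (by positivity) (mul_deriv_sq_le_energyDensity hm hb ht)

lemma sq_le_energyDensity (hm : m < 0) (hb : 0 < b) (ht : 0 < t) :
    f t ^ 2 ≤ ((-m)⁻¹ + b⁻¹) * energyDensity m b f f t := by
  have hm' : 0 < -m := by linarith
  have h1 : t⁻¹ * f t ^ 2 ≤ (-m)⁻¹ * energyDensity m b f f t := by
    rw [inv_mul_eq_div (-m), le_div_iff₀' hm']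
    exact inv_mul_sq_le_energyDensity hb ht
  have h2 : t ^ 3 * f t ^ 2 ≤ b⁻¹ * energyDensity m b f f t := by
    rw [inv_mul_eq_div b, le_div_iff₀' hb]
    exact cube_mul_sq_le_energyDensity hm ht
  have h3 : 1 ≤ t⁻¹ + t ^ 3 := by
    rcases le_total t 1 with h | h
    · have := (one_le_inv₀ ht).2 h
      have : 0 ≤ t ^ 3 := by positivity
      linarith
    · have := one_le_pow₀ (n := 3) h
      have : 0 ≤ t⁻¹ := by positivity
      linarith
  nlinarith [mul_le_mul_of_nonneg_right h3 (sq_nonneg (f t))]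

lemma abs_two_mul_mul_deriv_le_energyDensity (hm : m < 0) (hb : 0 < b) (ht : 0 < t) :
    |2 * f t * deriv f t| ≤ (1 + (-m)⁻¹) * energyDensity m b f f t := by
  have hm' : 0 < -m := by linarith
  have h1 : t⁻¹ * f t ^ 2 ≤ (-m)⁻¹ * energyDensity m b f f t := by
    rw [inv_mul_eq_div (-m), le_div_iff₀' hm']
    exact inv_mul_sq_le_energyDensity hb ht
  have h2 := mul_deriv_sq_le_energyDensity (f := f) hm hb ht
  have h3 : |2 * f t * deriv f t| ≤ t⁻¹ * f t ^ 2 + t * deriv f t ^ 2 := by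
    have e1 : t⁻¹ * f t ^ 2 + t * deriv f t ^ 2 - 2 * f t * deriv f t
        = t⁻¹ * (f t - t * deriv f t) ^ 2 := by field_simp; ring
    have e2 : t⁻¹ * f t ^ 2 + t * deriv f t ^ 2 + 2 * f t * deriv f t
        = t⁻¹ * (f t + t * deriv f t) ^ 2 := by field_simp; ring
    have p1 : 0 ≤ t⁻¹ * (f t - t * deriv f t) ^ 2 := by positivity
    have p2 : 0 ≤ t⁻¹ * (f t + t * deriv f t) ^ 2 := by positivity
    rw [abs_le]
    constructor <;> linarith
  linarith

lemma abs_energyDensity_le (hm : m < 0) (hb : 0 < b) (ht : 0 < t) :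
    |energyDensity m b f g t| ≤ energyDensity m b f f t + energyDensity m b g g t := by
  have hm' : 0 < -m := by linarith
  have key (s : ℝ) (hs : s ^ 2 = 1) : 0 ≤ energyDensity m b f f t + energyDensity m b g g t
      + 2 * s * energyDensity m b f g t := by
    have e : energyDensity m b f f t + energyDensity m b g g t
        + 2 * s * energyDensity m b f g t
        = t * (deriv f t + s * deriv g t) ^ 2 + -m * (t⁻¹ * (f t + s * g t) ^ 2)
          + b * t ^ 3 * (f t + s * g t) ^ 2 := by
      unfold energyDensity
      linear_combination
        -(t * deriv g t ^ 2 - m * t⁻¹ * g t ^ 2 + b * t ^ 3 * g t ^ 2) * hs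
    rw [e]
    positivity
  have h1 := key 1 (by norm_num)
  have h2 := key (-1) (by norm_num)
  have h3 := energyDensity_self_nonneg (f := f) hm hb ht
  have h4 := energyDensity_self_nonneg (f := g) hm hb ht
  rw [abs_le]
  constructor <;> linarith

end Pointwise

lemma continuousOn_energyDensity {f g : ℝ → ℝ} (m b : ℝ) (hf : ContDiffOn ℝ 1 f (Ioi 0))
    (hg : ContDiffOn ℝ 1 g (Ioi 0)) : ContinuousOn (energyDensity m b f g) (Ioi 0) := by
  have hf' := hf.continuousOn_deriv_of_isOpen isOpen_Ioi le_rfl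
  have hg' := hg.continuousOn_deriv_of_isOpen isOpen_Ioi le_rfl
  have hf0 := hf.continuousOn
  have hg0 := hg.continuousOn
  have hinv : ContinuousOn (fun t : ℝ => t⁻¹) (Ioi 0) :=
    continuousOn_inv₀.mono fun t ht => (ne_of_gt ht : t ≠ 0)
  unfold energyDensity
  fun_prop

lemma integrableOn_Ioi_of_abs_le {h k : ℝ → ℝ} (hh : ContinuousOn h (Ioi 0))
    (hk : IntegrableOn k (Ioi 0)) (hle : ∀ t, 0 < t → |h t| ≤ k t) : IntegrableOn h (Ioi 0) :=
  Integrable.mono' hk (hh.aestronglyMeasurable measurableSet_Ioi)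
    ((ae_restrict_mem measurableSet_Ioi).mono fun t ht => hle t ht)

lemma integrableOn_energyDensity {m b : ℝ} {f g : ℝ → ℝ} (hm : m < 0) (hb : 0 < b)
    (hf : ContDiffOn ℝ 1 f (Ioi 0)) (hg : ContDiffOn ℝ 1 g (Ioi 0))
    (hff : IntegrableOn (energyDensity m b f f) (Ioi 0))
    (hgg : IntegrableOn (energyDensity m b g g) (Ioi 0)) :
    IntegrableOn (energyDensity m b f g) (Ioi 0) :=
  integrableOn_Ioi_of_abs_le (continuousOn_energyDensity m b hf hg) (hff.add hgg)
    fun _ ht => abs_energyDensity_le hm hb ht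

/-- Point evaluations are bounded with respect to `‖·‖₂`, uniformly in the point. -/
lemma sq_le_integral_energyDensity {m b : ℝ} {f : ℝ → ℝ} (hm : m < 0) (hb : 0 < b)
    (hf : ContDiffOn ℝ 1 f (Ioi 0)) (hff : IntegrableOn (energyDensity m b f f) (Ioi 0))
    {t : ℝ} (ht : 0 < t) :
    f t ^ 2 ≤ (1 + (-m)⁻¹) * ∫ s in Ioi 0, energyDensity m b f f s := by
  have hf' := hf.continuousOn_deriv_of_isOpen isOpen_Ioi le_rfl
  have hf0 := hf.continuousOn
  have hsub : Ioi t ⊆ Ioi 0 := Ioi_subset_Ioi ht.le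
  have hd (s : ℝ) (hs : 0 < s) : HasDerivAt (fun s => f s ^ 2) (2 * f s * deriv f s) s := by
    have := ((hf.differentiableOn one_ne_zero).differentiableAt (Ioi_mem_nhds hs)).hasDerivAt.fun_pow 2
    simpa using this
  have hi : IntegrableOn (fun s => f s ^ 2) (Ioi 0) :=
    integrableOn_Ioi_of_abs_le (by fun_prop) (hff.const_mul ((-m)⁻¹ + b⁻¹)) fun s hs => by
      rw [abs_of_nonneg (sq_nonneg _)]
      exact sq_le_energyDensity hm hb hs
  have hi' : IntegrableOn (fun s => 2 * f s * deriv f s) (Ioi 0) :=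
    integrableOn_Ioi_of_abs_le (by fun_prop) (hff.const_mul (1 + (-m)⁻¹)) fun s hs =>
      abs_two_mul_mul_deriv_le_energyDensity hm hb hs
  have hlim := tendsto_zero_of_hasDerivAt_of_integrableOn_Ioi
    (fun s hs => hd s (hsub hs)) (hi'.mono_set hsub) (hi.mono_set hsub)
  have hftc := integral_Ioi_of_hasDerivAt_of_tendsto' (fun s hs => hd s (lt_of_lt_of_le ht hs))
    (hi'.mono_set hsub) hlim
  calc f t ^ 2 = -∫ s in Ioi t, 2 * f s * deriv f s := by rw [hftc]; ring
    _ ≤ |∫ s in Ioi t, 2 * f s * deriv f s| := neg_le_abs _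
    _ ≤ ∫ s in Ioi t, |2 * f s * deriv f s| := abs_integral_le_integral_abs
    _ ≤ ∫ s in Ioi 0, |2 * f s * deriv f s| :=
      setIntegral_mono_set hi'.abs (Filter.Eventually.of_forall fun _ => abs_nonneg _)
        hsub.eventuallyLE
    _ ≤ ∫ s in Ioi 0, (1 + (-m)⁻¹) * energyDensity m b f f s :=
      setIntegral_mono_on hi'.abs (hff.const_mul _) measurableSet_Ioi fun s hs =>
        abs_two_mul_mul_deriv_le_energyDensity hm hb hs
    _ = _ := integral_const_mul _ _

lemma energyDensity_sum {ι : Type*} (m b : ℝ) {u : ι → ℝ → ℝ}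
    (hu : ∀ i, ContDiffOn ℝ 1 (u i) (Ioi 0)) (F : Finset ι) (c : ι → ℝ) {t : ℝ} (ht : 0 < t) :
    energyDensity m b (fun s => ∑ i ∈ F, c i * u i s) (fun s => ∑ i ∈ F, c i * u i s) t
      = ∑ i ∈ F, ∑ j ∈ F, c i * c j * energyDensity m b (u i) (u j) t := by
  have hd (i : ι) : DifferentiableAt ℝ (u i) t :=
    ((hu i).differentiableOn one_ne_zero).differentiableAt (Ioi_mem_nhds ht)
  have hderiv : deriv (fun s => ∑ i ∈ F, c i * u i s) t = ∑ i ∈ F, c i * deriv (u i) t :=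
    (HasDerivAt.fun_sum fun i _ => (hd i).hasDerivAt.const_mul (c i)).deriv
  have hprod (a : ℝ) (p : ι → ℝ) : a * (∑ i ∈ F, p i) * ∑ i ∈ F, p i
      = ∑ i ∈ F, ∑ j ∈ F, a * p i * p j := by
    rw [mul_assoc, Finset.sum_mul_sum]
    simp only [Finset.mul_sum, mul_assoc]
  simp only [energyDensity, hderiv, hprod, ← Finset.sum_sub_distrib, ← Finset.sum_add_distrib]
  exact Finset.sum_congr rfl fun i _ => Finset.sum_congr rfl fun j _ => by ring

/-- Bessel's inequality for point evaluations along a `⟨·,·⟩₂`-orthogonal family. -/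
lemma sum_sq_div_integral_energyDensity_le {ι : Type*} {m b : ℝ} {u : ι → ℝ → ℝ} (hm : m < 0)
    (hb : 0 < b) (hu : ∀ i, ContDiffOn ℝ 1 (u i) (Ioi 0))
    (hint : ∀ i, IntegrableOn (energyDensity m b (u i) (u i)) (Ioi 0))
    (hpos : ∀ i, 0 < ∫ s in Ioi 0, energyDensity m b (u i) (u i) s)
    (horth : ∀ i j, i ≠ j → ∫ s in Ioi 0, energyDensity m b (u i) (u j) s = 0)
    (F : Finset ι) {t : ℝ} (ht : 0 < t) :
    ∑ i ∈ F, u i t ^ 2 / ∫ s in Ioi 0, energyDensity m b (u i) (u i) s ≤ 1 + (-m)⁻¹ := by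
  set N : ι → ℝ := fun i => ∫ s in Ioi 0, energyDensity m b (u i) (u i) s with hN
  set c : ι → ℝ := fun i => u i t / N i with hc
  set v : ℝ → ℝ := fun s => ∑ i ∈ F, c i * u i s with hv
  set S : ℝ := ∑ i ∈ F, u i t ^ 2 / N i with hS
  have hvt : v t = S := Finset.sum_congr rfl fun i _ => by simp only [hc]; ring
  have hvC : ContDiffOn ℝ 1 v (Ioi 0) :=
    ContDiffOn.sum fun i _ => contDiffOn_const.mul (hu i)
  have hcross (i j : ι) : IntegrableOn
      (fun s => c i * c j * energyDensity m b (u i) (u j) s) (Ioi 0) :=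
    (integrableOn_energyDensity hm hb (hu i) (hu j) (hint i) (hint j)).const_mul _
  have hvv : EqOn (energyDensity m b v v)
      (fun s => ∑ i ∈ F, ∑ j ∈ F, c i * c j * energyDensity m b (u i) (u j) s) (Ioi 0) :=
    fun s hs => energyDensity_sum m b hu F c hs
  have hvint : IntegrableOn (energyDensity m b v v) (Ioi 0) :=
    IntegrableOn.congr_fun
      (integrable_finsetSum _ fun i _ => integrable_finsetSum _ fun j _ => hcross i j)
      hvv.symm measurableSet_Ioi
  have hvN : ∫ s in Ioi 0, energyDensity m b v v s = S := by
    rw [setIntegral_congr_fun measurableSet_Ioi hvv,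
      integral_finsetSum _ fun i _ => integrable_finsetSum _ fun j _ => hcross i j]
    refine Finset.sum_congr rfl fun i hi => ?_
    rw [integral_finsetSum _ fun j _ => hcross i j, Finset.sum_eq_single_of_mem i hi]
    · rw [integral_const_mul]
      have := (hpos i).ne'
      change c i * c i * N i = _
      simp only [hc]
      field_simp
    · intro j _ hji
      rw [integral_const_mul, horth i j hji.symm, mul_zero]
  have h := sq_le_integral_energyDensity hm hb hvC hvint ht
  rw [hvt, hvN] at h
  have hS0 : 0 ≤ S := Finset.sum_nonneg fun i _ => div_nonneg (sq_nonneg _) (hpos i).le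
  rcases hS0.eq_or_lt with h0 | h0
  · rw [← h0]
    have : 0 < (-m)⁻¹ := by rw [inv_pos]; linarith
    linarith
  · nlinarith

lemma integrableOn_inv_one_add_sq_mul_sq {m b : ℝ} {f : ℝ → ℝ} (hm : m < 0) (hb : 0 < b)
    (hf : ContDiffOn ℝ 1 f (Ioi 0)) (hff : IntegrableOn (energyDensity m b f f) (Ioi 0)) :
    IntegrableOn (fun t => (1 + t ^ 2)⁻¹ * f t ^ 2) (Ioi 0) := by
  have hf0 := hf.continuousOn
  have hinv : Continuous fun t : ℝ => (1 + t ^ 2)⁻¹ :=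
    Continuous.inv₀ (by fun_prop) fun t => by positivity
  refine integrableOn_Ioi_of_abs_le (hinv.continuousOn.mul (hf0.pow 2))
    (hff.const_mul ((-m)⁻¹ + b⁻¹)) fun s hs => ?_
  rw [abs_of_nonneg (by positivity)]
  refine le_trans (mul_le_of_le_one_left (sq_nonneg _) ?_) (sq_le_energyDensity hm hb hs)
  exact inv_le_one_of_one_le₀ (by nlinarith [sq_nonneg s])

/-- The embedding of the energy space into `L²((0,∞), (1+t²)⁻¹ dt)` is Hilbert–Schmidt. -/
lemma summable_integral_inv_one_add_sq_mul_sq_div {ι : Type*} {m b : ℝ} {u : ι → ℝ → ℝ}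
    (hm : m < 0) (hb : 0 < b) (hu : ∀ i, ContDiffOn ℝ 1 (u i) (Ioi 0))
    (hint : ∀ i, IntegrableOn (energyDensity m b (u i) (u i)) (Ioi 0))
    (hpos : ∀ i, 0 < ∫ s in Ioi 0, energyDensity m b (u i) (u i) s)
    (horth : ∀ i j, i ≠ j → ∫ s in Ioi 0, energyDensity m b (u i) (u j) s = 0) :
    Summable fun i => (∫ t in Ioi (0 : ℝ), (1 + t ^ 2)⁻¹ * u i t ^ 2)
      / ∫ s in Ioi 0, energyDensity m b (u i) (u i) s := by
  have hi (i : ι) := integrableOn_inv_one_add_sq_mul_sq hm hb (hu i) (hint i)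
  refine summable_of_sum_le (c := ∫ t in Ioi (0 : ℝ), (1 + t ^ 2)⁻¹ * (1 + (-m)⁻¹))
    (fun i => div_nonneg (integral_nonneg fun t => by positivity) (hpos i).le) fun F => ?_
  simp only [← integral_div]
  rw [← integral_finsetSum _ fun i _ => (hi i).div_const _]
  refine setIntegral_mono_on (integrable_finsetSum _ fun i _ => (hi i).div_const _)
    (integrable_inv_one_add_sq.integrableOn.mul_const _) measurableSet_Ioi fun t ht => ?_
  have := sum_sq_div_integral_energyDensity_le hm hb hu hint hpos horth F ht
  simp only [mul_div_assoc, ← Finset.mul_sum]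
  gcongr

lemma rpow_le_cube_div_add {n : ℕ} (hn : 3 ≤ n) {x t : ℝ} (hx : 0 < x) (ht : 0 < t) :
    t ^ (3 - 4 / (n : ℝ)) ≤ t ^ 3 / x + (2 * (1 + x) ^ n) ^ 5 * (1 + t ^ 2)⁻¹ := by
  have hn0 : (0 : ℝ) < n := by positivity
  have hn3 : (3 : ℝ) ≤ n := by exact_mod_cast hn
  have hq : 4 / (n : ℝ) ≤ 3 := by rw [div_le_iff₀ hn0]; linarith
  have hfac : t ^ (3 - 4 / (n : ℝ)) = t ^ 3 / t ^ (4 / (n : ℝ)) := by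
    rw [Real.rpow_sub ht]
    norm_cast
  rcases le_total x (t ^ (4 / (n : ℝ))) with h | h
  · have : t ^ 3 / t ^ (4 / (n : ℝ)) ≤ t ^ 3 / x := by gcongr
    have : 0 ≤ (2 * (1 + x) ^ n) ^ 5 * (1 + t ^ 2)⁻¹ := by positivity
    linarith
  · have h1 : 1 + t ≤ 2 * (1 + x) ^ n := by
      have hone : 1 ≤ (1 + x) ^ n := one_le_pow₀ (by linarith)
      suffices t ≤ (1 + x) ^ n by linarith
      rcases le_total t 1 with h1 | h1
      · exact h1.trans hone
      calc t = t ^ (1 : ℝ) := (Real.rpow_one t).symm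
        _ ≤ t ^ (4 / (n : ℝ) * n) := Real.rpow_le_rpow_of_exponent_le h1 (by
          rw [div_mul_cancel₀ _ hn0.ne']; norm_num)
        _ = (t ^ (4 / (n : ℝ))) ^ n := by rw [Real.rpow_mul ht.le, Real.rpow_natCast]
        _ ≤ (1 + x) ^ n := by gcongr; linarith
    have h2 : t ^ (3 - 4 / (n : ℝ)) ≤ (1 + t) ^ 3 := by
      calc t ^ (3 - 4 / (n : ℝ)) ≤ (1 + t) ^ (3 - 4 / (n : ℝ)) :=
            Real.rpow_le_rpow ht.le (by linarith) (by linarith)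
        _ ≤ (1 + t) ^ (3 : ℝ) :=
            Real.rpow_le_rpow_of_exponent_le (by linarith) (by linarith [div_pos four_pos hn0])
        _ = (1 + t) ^ 3 := by norm_cast
    have h3 : t ^ (3 - 4 / (n : ℝ)) ≤ (2 * (1 + x) ^ n) ^ 5 * (1 + t ^ 2)⁻¹ := by
      rw [← div_eq_mul_inv, le_div_iff₀ (by positivity)]
      calc t ^ (3 - 4 / (n : ℝ)) * (1 + t ^ 2) ≤ (1 + t) ^ 3 * (1 + t) ^ 2 := by
            gcongr
            nlinarith
        _ = (1 + t) ^ 5 := by ring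
        _ ≤ _ := by gcongr
    have : 0 ≤ t ^ 3 / x := by positivity
    linarith

/-- A quantitative interpolation of the weight `t^{3-4/n}` between `t³` and `(1+t²)⁻¹`. -/
lemma integral_rpow_mul_sq_le {n : ℕ} (hn : 3 ≤ n) {m b x : ℝ} {f : ℝ → ℝ} (hm : m < 0)
    (hb : 0 < b) (hx : 0 < x) (hf : ContDiffOn ℝ 1 f (Ioi 0))
    (hff : IntegrableOn (energyDensity m b f f) (Ioi 0)) :
    ∫ t in Ioi (0 : ℝ), t ^ (3 - 4 / (n : ℝ)) * f t ^ 2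
      ≤ (∫ t in Ioi 0, energyDensity m b f f t) / (b * x)
        + (2 * (1 + x) ^ n) ^ 5 * ∫ t in Ioi (0 : ℝ), (1 + t ^ 2)⁻¹ * f t ^ 2 := by
  have hg := integrableOn_inv_one_add_sq_mul_sq hm hb hf hff
  have hk : IntegrableOn (fun t => energyDensity m b f f t / (b * x)
      + (2 * (1 + x) ^ n) ^ 5 * ((1 + t ^ 2)⁻¹ * f t ^ 2)) (Ioi 0) :=
    (hff.div_const (b * x)).add (hg.const_mul ((2 * (1 + x) ^ n) ^ 5))
  have hle (t : ℝ) (ht : 0 < t) : t ^ (3 - 4 / (n : ℝ)) * f t ^ 2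
      ≤ energyDensity m b f f t / (b * x)
        + (2 * (1 + x) ^ n) ^ 5 * ((1 + t ^ 2)⁻¹ * f t ^ 2) := by
    have h1 : t ^ 3 / x * f t ^ 2 ≤ energyDensity m b f f t / (b * x) := by
      rw [le_div_iff₀ (by positivity)]
      refine le_of_eq_of_le ?_ (cube_mul_sq_le_energyDensity hm ht)
      field_simp
    have h2 := mul_le_mul_of_nonneg_right (rpow_le_cube_div_add hn hx ht) (sq_nonneg (f t))
    linarith
  have hw : ContinuousOn (fun t : ℝ => t ^ (3 - 4 / (n : ℝ)) * f t ^ 2) (Ioi 0) :=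
    (continuousOn_id.rpow_const fun t ht => Or.inl (ne_of_gt ht)).mul (hf.continuousOn.pow 2)
  have hi := integrableOn_Ioi_of_abs_le hw hk fun t ht => by
    rw [abs_of_nonneg (by positivity)]
    exact hle t ht
  calc _ ≤ ∫ t in Ioi (0 : ℝ), (energyDensity m b f f t / (b * x)
        + (2 * (1 + x) ^ n) ^ 5 * ((1 + t ^ 2)⁻¹ * f t ^ 2)) :=
        setIntegral_mono_on hi hk measurableSet_Ioi hle
    _ = _ := by
      rw [integral_add (hff.div_const _) (hg.const_mul _), integral_div, integral_const_mul]

lemma one_add_pow_mul_exp_neg_le {c r : ℝ} (hc : 0 < c) (hr : 0 ≤ r) (k : ℕ) :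
    (1 + r) ^ k * Real.exp (-(c * r)) ≤ k.factorial * Real.exp c / c ^ k := by
  have h := Real.pow_div_factorial_le_exp (c * (1 + r)) (by positivity) k
  rw [mul_add, mul_one, Real.exp_add, div_le_iff₀ (by positivity)] at h
  rw [Real.exp_neg, ← div_eq_mul_inv, div_le_div_iff₀ (Real.exp_pos _) (by positivity)]
  calc (1 + r) ^ k * c ^ k = (c + c * r) ^ k := by rw [← mul_pow]; ring
    _ ≤ _ := h
    _ = k.factorial * Real.exp c * Real.exp (c * r) := by ring

/-- Trace-class property of `e^{−βH₀}` for the temporal Hamiltonian: if `(u_i)` are `C¹`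
functions on `(0,∞)` with finite positive `H₂`-norms which are `⟨·,·⟩₂`-orthogonal,
normalized by `∫₀^∞ t^{3−4/n}|u_i|² dt = 1`, and whose `H₂`-norms are comparable to
eigenvalues `λ_i ≥ λ₀ > 0` via `c₂ λ_i ≤ ‖u_i‖₂² ≤ c₁ λ_i`, then
`∑_i e^{−β λ_i} < ∞` for every `β > 0`. -/
theorem stmt16 (n : ℕ) (hn : 3 ≤ n) (mubar m₂' c₁ c₂ lam₀ β : ℝ)
    (hmubar : mubar < 0) (hm₂' : 0 < m₂') (hc₂ : 0 < c₂) (hcc : c₂ ≤ c₁)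
    (hlam₀ : 0 < lam₀) (hβ : 0 < β)
    (u : ℕ → ℝ → ℝ) (lam : ℕ → ℝ)
    (hreg : ∀ i, ContDiffOn ℝ 1 (u i) (Ioi 0))
    (hint : ∀ i, IntegrableOn
      (fun t => t * |deriv (u i) t| ^ 2 - mubar * t⁻¹ * |u i t| ^ 2
        + m₂' * t ^ 3 * |u i t| ^ 2) (Ioi 0))
    (hpos : ∀ i, 0 < ∫ t in Ioi (0 : ℝ),
      (t * |deriv (u i) t| ^ 2 - mubar * t⁻¹ * |u i t| ^ 2 + m₂' * t ^ 3 * |u i t| ^ 2))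
    (horth : ∀ i j, i ≠ j →
      (∫ t in Ioi (0 : ℝ),
        (t * deriv (u i) t * deriv (u j) t - mubar * t⁻¹ * u i t * u j t
          + m₂' * t ^ 3 * u i t * u j t)) = 0)
    (hnorm : ∀ i, (∫ t in Ioi (0 : ℝ), t ^ (3 - 4 / (n : ℝ)) * |u i t| ^ 2) = 1)
    (hlam : ∀ i, lam₀ ≤ lam i)
    (hlow : ∀ i, c₂ * lam i ≤ ∫ t in Ioi (0 : ℝ),
      (t * |deriv (u i) t| ^ 2 - mubar * t⁻¹ * |u i t| ^ 2 + m₂' * t ^ 3 * |u i t| ^ 2))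
    (hup : ∀ i, (∫ t in Ioi (0 : ℝ),
      (t * |deriv (u i) t| ^ 2 - mubar * t⁻¹ * |u i t| ^ 2 + m₂' * t ^ 3 * |u i t| ^ 2))
        ≤ c₁ * lam i) :
    Summable fun i => Real.exp (-β * lam i) := by
  have hc₁ : 0 < c₁ := hc₂.trans_le hcc
  simp only [← energyDensity_self] at hint hpos hup
  have horth' (i j : ℕ) (hij : i ≠ j) :
      ∫ s in Ioi 0, energyDensity mubar m₂' (u i) (u j) s = 0 := horth i j hij
  have hsum := summable_integral_inv_one_add_sq_mul_sq_div hmubar hm₂' hreg hint hpos horth'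
  set γ : ℝ := β * m₂' / (2 * c₁) with hγ
  have hγ0 : 0 < γ := by positivity
  set A : ℝ := (5 * n + 1).factorial * Real.exp γ / γ ^ (5 * n + 1)
  refine Summable.of_nonneg_of_le (fun i => (Real.exp_pos _).le) (fun i => ?_)
    (hsum.mul_left (32 * m₂' * A))
  set N : ℝ := ∫ s in Ioi 0, energyDensity mubar m₂' (u i) (u i) s with hN
  set G : ℝ := ∫ t in Ioi (0 : ℝ), (1 + t ^ 2)⁻¹ * u i t ^ 2
  have hN0 : 0 < N := hpos i
  set r : ℝ := 2 * N / m₂' with hr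
  have hr0 : 0 < r := by positivity
  have hNr : N = m₂' * r / 2 := by rw [hr]; field_simp
  have hG0 : 0 ≤ G := integral_nonneg fun t => by positivity
  have hhalf : 1 / 2 ≤ (2 * (1 + r) ^ n) ^ 5 * G := by
    have h := integral_rpow_mul_sq_le hn hmubar hm₂' hr0 (hreg i) (hint i)
    have h1 := hnorm i
    simp only [sq_abs] at h1
    rw [h1, ← hN] at h
    have : N / (m₂' * r) = 1 / 2 := by rw [hNr]; field_simp
    linarith
  have hexp : Real.exp (-β * lam i) ≤ Real.exp (-(γ * r)) := by
    rw [Real.exp_le_exp, neg_mul, neg_le_neg_iff]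
    have : γ * r = β * (N / c₁) := by rw [hγ, hr]; field_simp
    rw [this]
    gcongr
    rw [div_le_iff₀' hc₁]
    exact hup i
  have hA : (1 + r) ^ (5 * n + 1) * Real.exp (-(γ * r)) ≤ A :=
    one_add_pow_mul_exp_neg_le hγ0 hr0.le _
  have hNle : N ≤ m₂' * (1 + r) / 2 := by rw [hNr]; gcongr; linarith
  calc Real.exp (-β * lam i) ≤ Real.exp (-(γ * r)) := hexp
    _ ≤ Real.exp (-(γ * r)) * (2 * ((2 * (1 + r) ^ n) ^ 5 * G)) :=
      le_mul_of_one_le_right (Real.exp_pos _).le (by linarith)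
    _ = 64 * (1 + r) ^ (5 * n) * Real.exp (-(γ * r)) * N * (G / N) := by
      field_simp
      ring
    _ ≤ 64 * (1 + r) ^ (5 * n) * Real.exp (-(γ * r)) * (m₂' * (1 + r) / 2) * (G / N) := by
      gcongr
    _ = 32 * m₂' * ((1 + r) ^ (5 * n + 1) * Real.exp (-(γ * r))) * (G / N) := by ring
    _ ≤ 32 * m₂' * A * (G / N) := by gcongr
end

section
/- Let n ≥ 2, let Ω ⊂ ℝⁿ be a bounded open set with smooth boundary, and let ρ : Ω̄ → (real symmetric positive definite n×n matrices) be a smooth matrix field (a smooth Riemannian metric in the coordinates x on Ω). Then there exists a smooth diffeomorphism T from Ω̄ onto its image in ℝⁿ whose Jacobian determinant satisfies det DT(x) = √(det ρ(x)) for all x ∈ Ω; consequently the transformed metric ρ̃, defined by ρ̃_{kl}(T(x)) = ρ_{ij}(x) (∂x^i/∂x̃^k)(∂x^j/∂x̃^l), satisfies det ρ̃ = 1 on T(Ω). (One may take T = λ^{1/n} y, where y is the Dacorogna–Moser diffeomorphism with det Dy = λ√(det ρ), y = id on ∂Ω, and λ = (∫_Ω dx)/(∫_Ω √(det ρ) dx).)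 -/
open Set Matrix

/-- A bounded open set `Ω ⊆ ℝⁿ` has smooth boundary if near every boundary point it is
the sublevel set of a smooth function with nonvanishing differential. -/
def HasSmoothBoundary {n : ℕ} (Ω : Set (Fin n → ℝ)) : Prop :=
  ∀ x ∈ frontier Ω, ∃ (U : Set (Fin n → ℝ)) (f : (Fin n → ℝ) → ℝ),
    IsOpen U ∧ x ∈ U ∧ ContDiff ℝ (⊤ : ℕ∞) f ∧ (∀ y ∈ U, fderiv ℝ f y ≠ 0) ∧
    Ω ∩ U = {y ∈ U | f y < 0}

/-- Coefficients of the entire function `∑ cₖ xᵏ = ∏ (1 + 2⁻ⁱ x)`. -/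
noncomputable def qCoeff (k : ℕ) : ℝ :=
  ∏ i ∈ Finset.range k, ((1 / 2 : ℝ) ^ i / (1 - (1 / 2) ^ (i + 1)))

theorem one_sub_half_pow_succ_pos (i : ℕ) : 0 < 1 - (1 / 2 : ℝ) ^ (i + 1) :=
  sub_pos.2 (pow_lt_one₀ (by norm_num) (by norm_num) (Nat.succ_ne_zero i))

theorem qCoeff_pos (k : ℕ) : 0 < qCoeff k :=
  Finset.prod_pos fun i _ => div_pos (by positivity) (one_sub_half_pow_succ_pos i)

theorem qCoeff_succ (k : ℕ) :
    qCoeff (k + 1) = qCoeff k * ((1 / 2 : ℝ) ^ k / (1 - (1 / 2) ^ (k + 1))) :=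
  Finset.prod_range_succ _ _

theorem summable_qCoeff_mul_pow (x : ℝ) : Summable fun k => qCoeff k * x ^ k := by
  rcases eq_or_ne x 0 with rfl | hx
  · refine summable_of_ne_finset_zero (s := {0}) fun k hk => ?_
    rw [zero_pow (by simpa using hk), mul_zero]
  refine summable_of_ratio_test_tendsto_lt_one (l := 0) one_pos
    (.of_forall fun k => mul_ne_zero (qCoeff_pos k).ne' (pow_ne_zero _ hx)) ?_
  have h : ∀ k, ‖qCoeff (k + 1) * x ^ (k + 1)‖ / ‖qCoeff k * x ^ k‖
      = (1 / 2 : ℝ) ^ k / (1 - (1 / 2) ^ (k + 1)) * |x| := by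
    intro k
    have h1 := qCoeff_pos k
    have h2 := one_sub_half_pow_succ_pos k
    have h3 : |x| ≠ 0 := abs_ne_zero.2 hx
    rw [qCoeff_succ, norm_mul, norm_mul, norm_mul, norm_pow, norm_pow, Real.norm_eq_abs x,
      Real.norm_of_nonneg h1.le, Real.norm_of_nonneg (div_nonneg (by positivity) h2.le), pow_succ]
    field_simp
    rw [pow_succ]
  simp_rw [h]
  have h0 : Filter.Tendsto (fun k : ℕ => (1 / 2 : ℝ) ^ k) Filter.atTop (nhds 0) :=
    tendsto_pow_atTop_nhds_zero_of_lt_one (by norm_num) (by norm_num)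
  have h1 := ((h0.div ((h0.comp (Filter.tendsto_add_atTop_nat 1)).const_sub 1)
    (by norm_num)).mul_const |x|)
  simpa using h1

theorem tsum_qCoeff_mul_pow_eq (x : ℝ) :
    ∑' k, qCoeff k * x ^ k = (1 + x) * ∑' k, qCoeff k * (x / 2) ^ k := by
  have h1 := summable_qCoeff_mul_pow x
  have h2 := summable_qCoeff_mul_pow (x / 2)
  have h3 := h2.mul_left x
  rw [add_mul, one_mul, ← tsum_mul_left, h1.tsum_eq_zero_add, h2.tsum_eq_zero_add, add_assoc,
    ← Summable.tsum_add ((summable_nat_add_iff 1).2 h2) h3]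
  congr 1
  refine tsum_congr fun k => ?_
  have h := one_sub_half_pow_succ_pos k
  have hc : qCoeff (k + 1) = qCoeff (k + 1) * (1 / 2) ^ (k + 1) + qCoeff k * (1 / 2) ^ k := by
    rw [qCoeff_succ]
    field_simp
    ring
  calc qCoeff (k + 1) * x ^ (k + 1)
      = (qCoeff (k + 1) * (1 / 2) ^ (k + 1) + qCoeff k * (1 / 2) ^ k) * x ^ (k + 1) := by
        rw [← hc]
    _ = _ := by
        rw [div_eq_mul_one_div x 2, mul_pow, mul_pow]
        ring

theorem tsum_qCoeff_mul_neg_two_pow (j : ℕ) : ∑' k, qCoeff k * (-2 ^ j : ℝ) ^ k = 0 := by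
  induction j with
  | zero => rw [tsum_qCoeff_mul_pow_eq]; simp
  | succ j ih =>
    rw [tsum_qCoeff_mul_pow_eq, show (-2 ^ (j + 1) : ℝ) / 2 = -2 ^ j by ring, ih, mul_zero]

theorem tsum_qCoeff_mul_neg_half_ne_zero : ∑' k, qCoeff k * (-(1 / 2) : ℝ) ^ k ≠ 0 := by
  intro h
  have hz : ∀ j : ℕ, ∑' k, qCoeff k * (-(1 / 2) ^ (j + 1) : ℝ) ^ k = 0 := by
    intro j
    induction j with
    | zero => simpa using h
    | succ j ih =>
      rw [tsum_qCoeff_mul_pow_eq] at ih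
      rcases mul_eq_zero.1 ih with h' | h'
      · exact absurd h' (by linarith [one_sub_half_pow_succ_pos j])
      · rwa [show (-(1 / 2) ^ (j + 1) : ℝ) / 2 = -(1 / 2) ^ (j + 1 + 1) by ring] at h'
  have hcont : Filter.Tendsto (fun j : ℕ => ∑' k, qCoeff k * (-(1 / 2) ^ (j + 1) : ℝ) ^ k)
      Filter.atTop (nhds (∑' k, qCoeff k * (0 : ℝ) ^ k)) := by
    refine tendsto_tsum_of_dominated_convergence (summable_qCoeff_mul_pow 1) (fun k => ?_)
      (.of_forall fun j k => ?_)
    · have h0 : Filter.Tendsto (fun j : ℕ => (-(1 / 2) ^ (j + 1) : ℝ)) Filter.atTop (nhds 0) := by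
        simpa using ((tendsto_pow_atTop_nhds_zero_of_lt_one (r := (1 / 2 : ℝ)) (by norm_num)
          (by norm_num)).comp (Filter.tendsto_add_atTop_nat 1)).neg
      exact (h0.pow k).const_mul _
    · rw [norm_mul, Real.norm_of_nonneg (qCoeff_pos k).le, norm_pow, norm_neg, one_pow]
      refine mul_le_mul_of_nonneg_left (pow_le_one₀ (norm_nonneg _) ?_) (qCoeff_pos k).le
      rw [Real.norm_of_nonneg (by positivity)]
      linarith [one_sub_half_pow_succ_pos j]
  simp_rw [hz] at hcont
  have h1 : ∑' k, qCoeff k * (0 : ℝ) ^ k = 1 := by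
    rw [tsum_eq_single 0 fun k hk => by rw [zero_pow hk, mul_zero]]
    simp [qCoeff]
  rw [h1] at hcont
  exact zero_ne_one (tendsto_nhds_unique tendsto_const_nhds hcont)

/-- There are rapidly decaying weights on nodes `≥ 1` that integrate every polynomial to its value
at the origin. -/
theorem exists_weights_moments : ∃ a l : ℕ → ℝ, (∀ k, 1 ≤ l k) ∧
    (∀ j : ℕ, Summable fun k => |a k| * l k ^ j) ∧
    ∀ j : ℕ, ∑' k, a k * l k ^ j = if j = 0 then 1 else 0 := by
  set c := ∑' k, qCoeff k * (-(1 / 2) : ℝ) ^ k with hc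
  have hc0 : c ≠ 0 := tsum_qCoeff_mul_neg_half_ne_zero
  refine ⟨fun k => qCoeff k * (-(1 / 2)) ^ k / c, fun k => 2 ^ k,
    fun k => one_le_pow₀ (by norm_num), fun j => ?_, fun j => ?_⟩
  · refine ((summable_qCoeff_mul_pow (1 / 2 * 2 ^ j)).mul_right |c|⁻¹).congr fun k => ?_
    rw [abs_div, abs_mul, abs_of_pos (qCoeff_pos k), abs_pow, abs_neg, mul_pow, ← pow_mul,
      ← pow_mul, mul_comm k j, abs_of_pos (by norm_num : (0 : ℝ) < 1 / 2)]
    ring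
  · have h : ∀ k, qCoeff k * (-(1 / 2)) ^ k / c * ((2 : ℝ) ^ k) ^ j
        = qCoeff k * (-(1 / 2) * 2 ^ j) ^ k * c⁻¹ := by
      intro k
      rw [mul_pow, ← pow_mul, ← pow_mul, mul_comm k j]
      ring
    simp_rw [h]
    rw [tsum_mul_right]
    rcases j with _ | j
    · simp only [pow_zero, mul_one, if_true]
      rw [← hc, mul_inv_cancel₀ hc0]
    · rw [show (-(1 / 2) * 2 ^ (j + 1) : ℝ) = -2 ^ j by ring, tsum_qCoeff_mul_neg_two_pow]
      simp

/-- A multilinear map evaluated along an affine line is recovered at the base point by weights that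
integrate polynomials to their value at `0`. -/
theorem MultilinearMap.hasSum_smul_map_sub_smul {E F : Type*} [AddCommGroup E] [Module ℝ E]
    [AddCommGroup F] [Module ℝ F] [TopologicalSpace F] [IsTopologicalAddGroup F]
    [ContinuousSMul ℝ F] {a l : ℕ → ℝ} (hs : ∀ j : ℕ, Summable fun k => a k * l k ^ j)
    (ha : ∀ j : ℕ, ∑' k, a k * l k ^ j = if j = 0 then 1 else 0) {m : ℕ}
    (M : MultilinearMap ℝ (fun _ : Fin m => E) F) (v w : Fin m → E) :
    HasSum (fun k => a k • M (fun i => v i - l k • w i)) (M v) := by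
  classical
  have hexp : ∀ k, a k • M (fun i => v i - l k • w i)
      = ∑ s : Finset (Fin m), (a k * l k ^ s.card) • M (s.piecewise (-w) v) := by
    intro k
    have h1 : (fun i => v i - l k • w i) = (fun i => l k • (-w) i) + v := by
      ext i
      simp [sub_eq_add_neg, add_comm]
    rw [h1, M.map_add_univ, Finset.smul_sum]
    refine Finset.sum_congr rfl fun s _ => ?_
    have h2 : s.piecewise (fun i => l k • (-w) i) v
        = s.piecewise (fun i => (fun _ => l k) i • (s.piecewise (-w) v) i) (s.piecewise (-w) v) := by
      ext i
      by_cases hi : i ∈ s <;> simp [hi]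
    rw [h2, M.map_piecewise_smul, Finset.prod_const, smul_smul]
  simp_rw [hexp]
  have hsum : HasSum (fun k => ∑ s : Finset (Fin m), (a k * l k ^ s.card) • M (s.piecewise (-w) v))
      (∑ s : Finset (Fin m), (if s.card = 0 then (1 : ℝ) else 0) • M (s.piecewise (-w) v)) := by
    refine hasSum_sum fun s _ => ?_
    rw [← ha s.card]
    exact (hs s.card).hasSum.smul_const _
  convert! hsum using 1
  rw [Finset.sum_eq_single ∅]
  · simp
  · intro s _ hs
    simp [Finset.card_eq_zero, hs]
  · simp

section HalfSpace

variable {E F : Type*} [NormedAddCommGroup E] [NormedSpace ℝ E] [NormedAddCommGroup F]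
  [NormedSpace ℝ F]

/-- The linear map moving `x` by `c • τ x` in the direction `-e`. -/
def shearMap (τ : E →L[ℝ] ℝ) (e : E) (c : ℝ) : E →L[ℝ] E :=
  ContinuousLinearMap.id ℝ E - c • τ.smulRight e

theorem shearMap_apply (τ : E →L[ℝ] ℝ) (e : E) (c : ℝ) (x : E) :
    shearMap τ e c x = x - c • τ x • e := by
  simp [shearMap]

theorem apply_shearMap_nonpos {τ : E →L[ℝ] ℝ} {e : E} (he : τ e = 1) {c : ℝ} (hc : 1 ≤ c) {x : E}
    (hx : 0 ≤ τ x) : τ (shearMap τ e c x) ≤ 0 := by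
  rw [shearMap_apply, map_sub, map_smul, map_smul, he]
  simp only [smul_eq_mul, mul_one]
  nlinarith

theorem norm_shearMap_le (τ : E →L[ℝ] ℝ) (e : E) {c : ℝ} (hc : 1 ≤ c) :
    ‖shearMap τ e c‖ ≤ c * (1 + ‖τ‖ * ‖e‖) := by
  calc ‖shearMap τ e c‖ ≤ ‖ContinuousLinearMap.id ℝ E‖ + ‖c • τ.smulRight e‖ := norm_sub_le _ _
    _ ≤ 1 + c * (‖τ‖ * ‖e‖) := by
        refine add_le_add ContinuousLinearMap.norm_id_le ?_
        rw [norm_smul, ContinuousLinearMap.norm_smulRight_apply, Real.norm_of_nonneg (by linarith)]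
    _ ≤ c * (1 + ‖τ‖ * ‖e‖) := by nlinarith [mul_nonneg (norm_nonneg τ) (norm_nonneg e)]

/-- The reflected series, transporting the jet `D` of a function on `{τ ≤ 0}` to `{τ ≥ 0}`. -/
noncomputable def reflectedJet (a l : ℕ → ℝ) (τ : E →L[ℝ] ℝ) (e : E)
    (D : E → FormalMultilinearSeries ℝ E F) (m : ℕ) (x : E) : E [×m]→L[ℝ] F :=
  ∑' k, a k • (D (shearMap τ e (l k) x) m).compContinuousLinearMap fun _ => shearMap τ e (l k)

theorem norm_reflectedJet_term_le {a l : ℕ → ℝ} (hl : ∀ k, 1 ≤ l k) {τ : E →L[ℝ] ℝ} {e : E}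
    (he : τ e = 1) {D : E → FormalMultilinearSeries ℝ E F} {m : ℕ} {C : ℝ}
    (hC : ∀ x, τ x ≤ 0 → ‖D x m‖ ≤ C) (k : ℕ) {x : E} (hx : 0 ≤ τ x) :
    ‖a k • (D (shearMap τ e (l k) x) m).compContinuousLinearMap fun _ => shearMap τ e (l k)‖
      ≤ |a k| * l k ^ m * (C * (1 + ‖τ‖ * ‖e‖) ^ m) := by
  have hb := hC _ (apply_shearMap_nonpos he (hl k) hx)
  rw [norm_smul, Real.norm_eq_abs]
  calc |a k| * _ ≤ |a k| * (‖D (shearMap τ e (l k) x) m‖ * ∏ _i : Fin m, ‖shearMap τ e (l k)‖) := by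
        gcongr
        exact ContinuousMultilinearMap.norm_compContinuousLinearMap_le _ _
    _ ≤ |a k| * (C * (l k * (1 + ‖τ‖ * ‖e‖)) ^ m) := by
        rw [Finset.prod_const, Finset.card_fin]
        gcongr
        · exact (norm_nonneg _).trans hb
        · exact norm_shearMap_le τ e (hl k)
    _ = _ := by rw [mul_pow]; ring

variable [CompleteSpace F] {a l : ℕ → ℝ} {τ : E →L[ℝ] ℝ} {e : E}
  {D : E → FormalMultilinearSeries ℝ E F}

theorem reflectedJet_eq_of_apply_eq_zero (hs : ∀ j : ℕ, Summable fun k => |a k| * l k ^ j)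
    (hl : ∀ k, 1 ≤ l k)
    (ha : ∀ j : ℕ, ∑' k, a k * l k ^ j = if j = 0 then 1 else 0) (he : τ e = 1)
    (hbd : ∀ m, ∃ C, ∀ x, τ x ≤ 0 → ‖D x m‖ ≤ C) (m : ℕ) {x : E} (hx : τ x = 0) :
    reflectedJet a l τ e D m x = D x m := by
  obtain ⟨C, hC⟩ := hbd m
  have hsum : Summable fun k =>
      a k • (D (shearMap τ e (l k) x) m).compContinuousLinearMap fun _ => shearMap τ e (l k) :=
    .of_norm_bounded ((hs m).mul_right _) fun k => norm_reflectedJet_term_le hl he hC k hx.ge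
  have hs' : ∀ j : ℕ, Summable fun k => a k * l k ^ j := fun j =>
    .of_norm_bounded (hs j) fun k => by
      rw [norm_mul, norm_pow, Real.norm_eq_abs, Real.norm_of_nonneg (by linarith [hl k])]
  have hfix : ∀ c, shearMap τ e c x = x := fun c => by simp [shearMap_apply, hx]
  ext v
  have h := hsum.hasSum.mapL (ContinuousMultilinearMap.apply ℝ (fun _ : Fin m => E) F v)
  refine h.unique ?_
  have h' := MultilinearMap.hasSum_smul_map_sub_smul hs' ha (D x m).toMultilinearMap v
    (fun i => τ (v i) • e)
  refine h'.congr_fun fun k => ?_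
  simp [hfix, shearMap_apply]

theorem continuousOn_reflectedJet (hs : ∀ j : ℕ, Summable fun k => |a k| * l k ^ j)
    (hl : ∀ k, 1 ≤ l k) (he : τ e = 1)
    (hbd : ∀ m, ∃ C, ∀ x, τ x ≤ 0 → ‖D x m‖ ≤ C) (m : ℕ)
    (hD : ContinuousOn (fun x => D x m) {x | τ x ≤ 0}) :
    ContinuousOn (reflectedJet a l τ e D m) {x | 0 ≤ τ x} := by
  obtain ⟨C, hC⟩ := hbd m
  refine continuousOn_tsum (fun k => ?_) ((hs m).mul_right _)
    fun k x hx => norm_reflectedJet_term_le hl he hC k hx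
  have h : ContinuousOn (fun x => D (shearMap τ e (l k) x) m) {x | 0 ≤ τ x} :=
    hD.comp (shearMap τ e (l k)).continuous.continuousOn
      fun x hx => apply_shearMap_nonpos he (hl k) hx
  exact ((ContinuousMultilinearMap.compContinuousLinearMapL (F := F)
    (fun _ : Fin m => shearMap τ e (l k))).continuous.comp_continuousOn h).const_smul (a k)

theorem hasFDerivAt_reflectedJet (hs : ∀ j : ℕ, Summable fun k => |a k| * l k ^ j)
    (hl : ∀ k, 1 ≤ l k) (he : τ e = 1)
    (hbd : ∀ m, ∃ C, ∀ x, τ x ≤ 0 → ‖D x m‖ ≤ C) (m : ℕ)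
    (hD : ∀ x, τ x ≤ 0 → HasFDerivWithinAt (fun x => D x m) (D x (m + 1)).curryLeft {x | τ x ≤ 0} x)
    {x : E} (hx : 0 < τ x) :
    HasFDerivAt (reflectedJet a l τ e D m) (reflectedJet a l τ e D (m + 1) x).curryLeft x := by
  obtain ⟨C, hC⟩ := hbd m
  obtain ⟨C', hC'⟩ := hbd (m + 1)
  have hopen : IsOpen {x | 0 < τ x} := isOpen_lt continuous_const τ.continuous
  have hconv : Convex ℝ {x | 0 < τ x} := convex_halfSpace_gt τ.isLinear 0
  let J := continuousMultilinearCurryLeftEquiv ℝ (fun _ : Fin (m + 1) => E) F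
  let t : ℕ → E → E [×(m + 1)]→L[ℝ] F := fun k x =>
    a k • (D (shearMap τ e (l k) x) (m + 1)).compContinuousLinearMap fun _ => shearMap τ e (l k)
  have ht : ∀ k y, 0 < τ y → ‖t k y‖ ≤ |a k| * l k ^ (m + 1) * (C' * (1 + ‖τ‖ * ‖e‖) ^ (m + 1)) :=
    fun k y hy => norm_reflectedJet_term_le hl he hC' k hy.le
  have hsum : Summable fun k => t k x :=
    .of_norm_bounded ((hs (m + 1)).mul_right _) fun k => ht k x hx
  have hJ : (reflectedJet a l τ e D (m + 1) x).curryLeft = ∑' k, J (t k x) :=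
    J.toContinuousLinearEquiv.map_tsum (f := fun k => t k x)
  rw [hJ]
  refine hasFDerivAt_tsum_of_isPreconnected (s := {x | 0 < τ x}) (x₀ := x)
    (f' := fun k y => J (t k y))
    ((hs (m + 1)).mul_right (C' * (1 + ‖τ‖ * ‖e‖) ^ (m + 1))) hopen
    hconv.isPreconnected (fun k y hy => ?_) (fun k y hy => ?_) hx
    (.of_norm_bounded ((hs m).mul_right _) fun k => norm_reflectedJet_term_le hl he hC k hx.le) hx
  · have h1 : HasFDerivAt (fun y => D (shearMap τ e (l k) y) m)
        ((D (shearMap τ e (l k) y) (m + 1)).curryLeft.comp (shearMap τ e (l k))) y :=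
      ((hD _ (apply_shearMap_nonpos he (hl k) (le_of_lt hy))).comp y
        (shearMap τ e (l k)).hasFDerivAt.hasFDerivWithinAt
        (fun z hz => apply_shearMap_nonpos he (hl k) (le_of_lt hz))).hasFDerivAt
        (hopen.mem_nhds hy)
    have h2 := ((ContinuousMultilinearMap.compContinuousLinearMapL (F := F)
      (fun _ : Fin m => shearMap τ e (l k))).hasFDerivAt.comp y h1).const_smul (a k)
    refine h2.congr_fderiv ?_
    ext v w
    simp only [J, t]
    simp [ContinuousMultilinearMap.curryLeft_apply]
    congr 2
    ext i
    refine Fin.cases ?_ (fun i => ?_) i <;> simp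
  · rw [J.norm_map]
    exact ht k y hy

/-- A function that is smooth on a closed half-space, with bounded derivatives of all orders,
extends to a smooth function on the whole space. -/
theorem exists_contDiff_eqOn_halfSpace (he : τ e = 1) {f : E → F}
    (hf : ContDiffOn ℝ (⊤ : ℕ∞) f {x | τ x ≤ 0})
    (hbd : ∀ m : ℕ, ∃ C, ∀ x, τ x ≤ 0 → ‖iteratedFDerivWithin ℝ m f {x | τ x ≤ 0} x‖ ≤ C) :
    ∃ g : E → F, ContDiff ℝ (⊤ : ℕ∞) g ∧ EqOn g f {x | τ x ≤ 0} := by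
  obtain ⟨a, l, hl, hs, ha⟩ := exists_weights_moments
  set H : Set E := {x | τ x ≤ 0} with hH
  set D := ftaylorSeriesWithin ℝ f H with hDdef
  have hopen : IsOpen {x | 0 < τ x} := isOpen_lt continuous_const τ.continuous
  have hopen' : IsOpen {x | τ x < 0} := isOpen_lt τ.continuous continuous_const
  have hclosed : IsClosed H := isClosed_le τ.continuous continuous_const
  have huniq : UniqueDiffOn ℝ H := by
    refine uniqueDiffOn_convex (convex_halfSpace_le τ.isLinear 0) ⟨-e, ?_⟩
    refine interior_maximal (fun x (hx : τ x < 0) => hx.le) hopen' ?_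
    change τ (-e) < 0
    simp [he]
  have hT : HasFTaylorSeriesUpToOn (⊤ : ℕ∞) f D H := hf.ftaylorSeriesWithin huniq
  have hlt : ∀ m : ℕ, (m : WithTop ℕ∞) < (⊤ : ℕ∞) := fun m => by
    exact_mod_cast ENat.natCast_lt_top m
  have hD : ∀ m : ℕ, ∀ x, τ x ≤ 0 →
      HasFDerivWithinAt (fun x => D x m) (D x (m + 1)).curryLeft H x :=
    fun m x hx => hT.fderivWithin m (hlt m) x hx
  have hcl : closure {x | 0 < τ x} = {x | 0 ≤ τ x} := by
    refine (closure_lt_subset_le continuous_const τ.continuous).antisymm fun x hx => ?_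
    have hlim : Filter.Tendsto (fun t : ℝ => x + t • e) (nhdsWithin 0 (Ioi 0)) (nhds x) := by
      have : Continuous fun t : ℝ => x + t • e := by fun_prop
      simpa using (this.tendsto 0).mono_left nhdsWithin_le_nhds
    refine mem_closure_of_tendsto hlim ?_
    filter_upwards [self_mem_nhdsWithin] with t ht
    have hx' : 0 ≤ τ x := hx
    have ht' : 0 < t := ht
    change 0 < τ (x + t • e)
    simp only [map_add, map_smul, he, smul_eq_mul, mul_one]
    linarith
  let Q := reflectedJet a l τ e D
  have hQD : ∀ m x, τ x = 0 → Q m x = D x m := fun m x hx =>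
    reflectedJet_eq_of_apply_eq_zero hs hl ha he hbd m hx
  have hQcont : ∀ m, ContinuousOn (Q m) {x | 0 ≤ τ x} := fun m =>
    continuousOn_reflectedJet hs hl he hbd m (hT.cont m (hlt m).le)
  have hQ : ∀ m x, 0 < τ x → HasFDerivAt (Q m) (Q (m + 1) x).curryLeft x := fun m x hx =>
    hasFDerivAt_reflectedJet hs hl he hbd m (hD m) hx
  have hQ' : ∀ m x, 0 ≤ τ x →
      HasFDerivWithinAt (Q m) (Q (m + 1) x).curryLeft {x | 0 ≤ τ x} x := by
    intro m x hx
    rw [← hcl]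
    refine hasFDerivWithinAt_closure_of_tendsto_fderiv
      (fun y hy => (hQ m y hy).differentiableAt.differentiableWithinAt)
      (convex_halfSpace_gt τ.isLinear 0) hopen (fun y hy => ?_) ?_
    · rw [hcl] at hy
      exact (hQcont m y hy).mono fun z (hz : 0 < τ z) => hz.le
    · have h1 : Filter.Tendsto (fun y => (Q (m + 1) y).curryLeft) (nhdsWithin x {x | 0 < τ x})
          (nhds (Q (m + 1) x).curryLeft) :=
        ((continuousMultilinearCurryLeftEquiv ℝ (fun _ : Fin (m + 1) => E) F).continuous.tendsto
          _).comp ((hQcont (m + 1) x hx).mono_left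
            (nhdsWithin_mono _ fun z (hz : 0 < τ z) => hz.le))
      refine h1.congr' ?_
      filter_upwards [self_mem_nhdsWithin] with y hy using (hQ m y hy).fderiv.symm
  classical
  let P : E → FormalMultilinearSeries ℝ E F := fun x m => if τ x ≤ 0 then D x m else Q m x
  have hPD : ∀ m x, τ x ≤ 0 → P x m = D x m := fun m x hx => if_pos hx
  have hPQ : ∀ m x, 0 ≤ τ x → P x m = Q m x := by
    intro m x hx
    rcases hx.eq_or_lt with h | h
    · rw [hPD m x h.ge, hQD m x h.symm]
    · exact if_neg h.not_ge
  have hP : ∀ m x, HasFDerivAt (fun y => P y m) (P x (m + 1)).curryLeft x := by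
    intro m x
    have hun : H ∪ {x | 0 ≤ τ x} = univ := by
      ext y
      simpa [H] using le_total (τ y) 0
    rw [← hasFDerivWithinAt_univ, ← hun]
    refine HasFDerivWithinAt.union ?_ ?_
    · by_cases hx : τ x ≤ 0
      · rw [hPD _ x hx]
        exact (hD m x hx).congr (fun y hy => hPD m y hy) (hPD m x hx)
      · exact .of_notMem_closure (by rwa [hclosed.closure_eq])
    · by_cases hx : 0 ≤ τ x
      · rw [hPQ _ x hx]
        exact (hQ' m x hx).congr (fun y hy => hPQ m y hy) (hPQ m x hx)
      · exact .of_notMem_closure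
          (by rwa [(isClosed_le continuous_const τ.continuous).closure_eq])
  refine ⟨fun x => (P x 0).curry0, ?_, fun x hx => ?_⟩
  · have : HasFTaylorSeriesUpTo (⊤ : ℕ∞) (fun x => (P x 0).curry0) P :=
      ⟨fun _ => rfl, fun m _ x => hP m x,
        fun m _ => continuous_iff_continuousAt.2 fun x => (hP m x).continuousAt⟩
    exact this.contDiff
  · simp only [hPD 0 x hx]
    exact hT.zero_eq x hx

end HalfSpace

theorem exists_bound_iteratedFDerivWithin_of_compact {E F : Type*} [NormedAddCommGroup E]
    [NormedSpace ℝ E] [NormedAddCommGroup F] [NormedSpace ℝ F] {H K : Set E} {f : E → F}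
    (hH : UniqueDiffOn ℝ H) (hHc : IsClosed H) (hK : IsCompact K)
    (hf : ContDiffOn ℝ (⊤ : ℕ∞) f H) (h0 : ∀ x ∉ K, f x = 0) (m : ℕ) :
    ∃ C, ∀ x ∈ H, ‖iteratedFDerivWithin ℝ m f H x‖ ≤ C := by
  have hcont : ContinuousOn (iteratedFDerivWithin ℝ m f H) H :=
    hf.continuousOn_iteratedFDerivWithin (by exact_mod_cast (ENat.natCast_lt_top m).le) hH
  obtain ⟨C, hC⟩ := (hK.inter_right hHc).exists_bound_of_continuousOn
    (hcont.mono inter_subset_right)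
  refine ⟨max C 0, fun x hx => ?_⟩
  by_cases hxK : x ∈ K
  · exact (hC x ⟨hxK, hx⟩).trans (le_max_left _ _)
  · have hev : f =ᶠ[nhdsWithin x H] fun _ => (0 : F) :=
      nhdsWithin_le_nhds (Filter.eventually_of_mem (hK.isClosed.isOpen_compl.mem_nhds hxK) h0)
    rw [hev.iteratedFDerivWithin_eq (h0 x hxK)]
    simp

/-- A function that is smooth on a closed set agrees, near a point where the set is the sublevel
set of a submersion, with a function that is smooth on a full neighbourhood. -/
theorem exists_contDiff_eq_of_sublevel {E : Type*} [NormedAddCommGroup E] [NormedSpace ℝ E]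
    [FiniteDimensional ℝ E] {S U : Set E} {h f : E → ℝ} {p : E} (hU : IsOpen U) (hp : p ∈ U)
    (hh : ContDiff ℝ (⊤ : ℕ∞) h) (hdh : fderiv ℝ h p ≠ 0) (hS : ∀ y ∈ U, y ∈ S ↔ h y ≤ 0)
    (hf : ContDiffOn ℝ (⊤ : ℕ∞) f S) :
    ∃ g : E → ℝ, ContDiff ℝ (⊤ : ℕ∞) g ∧ ∀ᶠ y in nhds p, y ∈ S → g y = f y := by
  have : CompleteSpace E := FiniteDimensional.complete ℝ E
  set τ := fderiv ℝ h p with hτ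
  obtain ⟨e, he⟩ : ∃ e, τ e = 1 := by
    obtain ⟨v, hv⟩ : ∃ v, τ v ≠ 0 := by
      by_contra! hcon
      exact hdh (ContinuousLinearMap.ext hcon)
    exact ⟨(τ v)⁻¹ • v, by simp [hv]⟩
  let φ : E → E := fun x => x + (h x - τ x) • e
  have hφ : ContDiff ℝ (⊤ : ℕ∞) φ :=
    contDiff_id.add ((hh.sub τ.contDiff).smul contDiff_const)
  have hτφ : ∀ x, τ (φ x) = h x := fun x => by simp [φ, he]
  have hφp : HasFDerivAt φ ((ContinuousLinearEquiv.refl ℝ E : E ≃L[ℝ] E) : E →L[ℝ] E) p := by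
    have h1 : HasFDerivAt h τ p := (hh.differentiable (by simp) p).hasFDerivAt
    refine ((hasFDerivAt_id p).add ((h1.sub τ.hasFDerivAt).smul_const e)).congr_fderiv ?_
    ext v
    simp
  let Φ := hφ.contDiffAt.toOpenPartialHomeomorph φ hφp (by simp)
  have hΦ : ∀ x, Φ x = φ x := fun x => rfl
  have hpΦ : p ∈ Φ.source := hφ.contDiffAt.mem_toOpenPartialHomeomorph_source hφp (by simp)
  let W : Set E := U ∩ fderiv ℝ φ ⁻¹' range ((↑) : (E ≃L[ℝ] E) → E →L[ℝ] E)
  have hW : IsOpen W :=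
    hU.inter (ContinuousLinearEquiv.isOpen.preimage (hφ.continuous_fderiv (by simp)))
  have hpW : p ∈ W := ⟨hp, ⟨_, hφp.fderiv.symm⟩⟩
  let W' : Set E := Φ.target ∩ Φ.symm ⁻¹' W
  have hW' : IsOpen W' := Φ.isOpen_inter_preimage_symm hW
  have hsymm : Φ.symm (φ p) = p := Φ.left_inv hpΦ
  have hpW' : φ p ∈ W' := ⟨Φ.map_source hpΦ, by rw [mem_preimage, hsymm]; exact hpW⟩
  have hΦsymm : ∀ y ∈ W', ContDiffAt ℝ (⊤ : ℕ∞) Φ.symm y := by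
    rintro y ⟨hy, -, A, hA⟩
    refine Φ.contDiffAt_symm (f₀' := A) hy ?_ hφ.contDiffAt
    rw [hA]
    exact (hφ.differentiable (by simp) _).hasFDerivAt
  obtain ⟨r, hr, hball⟩ := Metric.isOpen_iff.1 hW' _ hpW'
  let χ : ContDiffBump (φ p) := ⟨r / 3, r / 2, by positivity, by linarith⟩
  have hχ0 : ∀ y ∉ Metric.closedBall (φ p) (r / 2), χ y = 0 := fun y hy =>
    χ.zero_of_le_dist (by simpa using (not_le.1 hy).le)
  set H : Set E := {x | τ x ≤ 0} with hHdef
  have hclosed : IsClosed H := isClosed_le τ.continuous continuous_const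
  have huniq : UniqueDiffOn ℝ H := by
    refine uniqueDiffOn_convex (convex_halfSpace_le τ.isLinear 0) ⟨-e, ?_⟩
    refine interior_maximal (fun x (hx : τ x < 0) => hx.le)
      (isOpen_lt τ.continuous continuous_const) ?_
    change τ (-e) < 0
    simp [he]
  let G : E → ℝ := fun y => χ y * f (Φ.symm y)
  have hG0 : ∀ y ∉ Metric.closedBall (φ p) (r / 2), G y = 0 := fun y hy => by
    simp [G, hχ0 y hy]
  have hG : ContDiffOn ℝ (⊤ : ℕ∞) G H := by
    intro y hy
    by_cases hyb : y ∈ Metric.closedBall (φ p) (r / 2)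
    · have hyW : y ∈ W' := hball (Metric.closedBall_subset_ball (by linarith) hyb)
      have hmaps : MapsTo Φ.symm (H ∩ W') S := by
        rintro z ⟨hz, hzW⟩
        rw [hS _ hzW.2.1, ← hτφ, ← hΦ, Φ.right_inv hzW.1]
        exact hz
      have hcomp : ContDiffWithinAt ℝ (⊤ : ℕ∞) (f ∘ Φ.symm) (H ∩ W') y :=
        (hf _ (hmaps ⟨hy, hyW⟩)).comp y (hΦsymm y hyW).contDiffWithinAt hmaps
      exact (χ.contDiff.contDiffAt.contDiffWithinAt).mul
        ((contDiffWithinAt_inter (hW'.mem_nhds hyW)).1 hcomp)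
    · have hev : G =ᶠ[nhds y] fun _ => (0 : ℝ) :=
        Filter.eventually_of_mem (Metric.isClosed_closedBall.isOpen_compl.mem_nhds hyb) hG0
      exact (contDiffAt_const.congr_of_eventuallyEq hev).contDiffWithinAt
  obtain ⟨g, hg, hgG⟩ := exists_contDiff_eqOn_halfSpace he hG fun m =>
    exists_bound_iteratedFDerivWithin_of_compact huniq hclosed
      (isCompact_closedBall (φ p) (r / 2)) hG hG0 m
  refine ⟨g ∘ φ, hg.comp hφ, ?_⟩
  filter_upwards [hU.mem_nhds hp, Φ.open_source.mem_nhds hpΦ,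
    hφ.continuous.continuousAt.preimage_mem_nhds (Metric.ball_mem_nhds (φ p)
      (by positivity : 0 < r / 3))] with y hyU hys hyb hyS
  have hyH : φ y ∈ H := by
    change τ (φ y) ≤ 0
    rw [hτφ]
    exact (hS y hyU).1 hyS
  have h1 : χ (φ y) = 1 := χ.one_of_mem_closedBall (Metric.ball_subset_closedBall hyb)
  have h2 : Φ.symm (φ y) = y := Φ.left_inv hys
  rw [Function.comp_apply, hgG hyH]
  simp only [G, h1, h2, one_mul]

theorem HasSmoothBoundary.exists_mem_closure_iff {n : ℕ} {Ω : Set (Fin n → ℝ)}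
    (hΩ : HasSmoothBoundary Ω) {x : Fin n → ℝ} (hx : x ∈ frontier Ω) :
    ∃ (U : Set (Fin n → ℝ)) (h : (Fin n → ℝ) → ℝ), IsOpen U ∧ x ∈ U ∧
      ContDiff ℝ (⊤ : ℕ∞) h ∧ fderiv ℝ h x ≠ 0 ∧ ∀ y ∈ U, y ∈ closure Ω ↔ h y ≤ 0 := by
  obtain ⟨U, h, hU, hxU, hh, hdh, hΩU⟩ := hΩ x hx
  have hiff : ∀ y ∈ U, y ∈ Ω ↔ h y < 0 := fun y hy =>
    ⟨fun hyΩ => (hΩU.subset ⟨hyΩ, hy⟩).2, fun hlt => (hΩU.superset ⟨hy, hlt⟩).1⟩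
  refine ⟨U, h, hU, hxU, hh, hdh x hxU, fun y hy => ⟨fun hcl => ?_, fun hle => ?_⟩⟩
  · by_contra! hpos
    obtain ⟨z, ⟨hzU, hz⟩, hzΩ⟩ := mem_closure_iff.1 hcl _
      (hU.inter (isOpen_lt continuous_const hh.continuous)) ⟨hy, hpos⟩
    exact lt_asymm hz ((hiff z hzU).1 hzΩ)
  · by_contra hcl
    have hy0 : h y = 0 := by
      by_contra hne
      exact hcl (subset_closure ((hiff y hy).2 (lt_of_le_of_ne hle hne)))
    refine hdh y hy (IsLocalMin.fderiv_eq_zero ?_)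
    filter_upwards [hU.mem_nhds hy, isClosed_closure.isOpen_compl.mem_nhds hcl] with z hzU hz
    rw [hy0]
    by_contra! hlt
    exact hz (subset_closure ((hiff z hzU).2 hlt))

/-- A positive function that is smooth up to the boundary of a domain with smooth boundary extends
to a positive smooth function on the whole space. -/
theorem HasSmoothBoundary.exists_contDiff_pos_eqOn {n : ℕ} {Ω : Set (Fin n → ℝ)}
    (hΩ : HasSmoothBoundary Ω) (hopen : IsOpen Ω) {f : (Fin n → ℝ) → ℝ}
    (hf : ContDiffOn ℝ (⊤ : ℕ∞) f (closure Ω)) (hpos : ∀ x ∈ closure Ω, 0 < f x) :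
    ∃ g : (Fin n → ℝ) → ℝ, ContDiff ℝ (⊤ : ℕ∞) g ∧ (∀ x, 0 < g x) ∧ EqOn g f (closure Ω) := by
  classical
  let t : (Fin n → ℝ) → Set ℝ := fun x => if x ∈ closure Ω then {f x} else Ioi 0
  have htin : ∀ x ∈ closure Ω, t x = {f x} := fun x hx => if_pos hx
  have htout : ∀ x ∉ closure Ω, t x = Ioi 0 := fun x hx => if_neg hx
  have htconv : ∀ x, Convex ℝ (t x) := by
    intro x
    by_cases hx : x ∈ closure Ω
    · rw [htin x hx]
      exact convex_singleton _
    · rw [htout x hx]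
      exact convex_Ioi _
  have hloc : ∀ x, ∃ V ∈ nhds x, ∃ g : (Fin n → ℝ) → ℝ,
      ContDiffOn ℝ (⊤ : ℕ∞) g V ∧ ∀ y ∈ V, g y ∈ t y := by
    intro x
    by_cases hx : x ∈ closure Ω
    · by_cases hxΩ : x ∈ Ω
      · refine ⟨Ω, hopen.mem_nhds hxΩ, f, hf.mono subset_closure, fun y hy => ?_⟩
        rw [htin y (subset_closure hy)]
        rfl
      · have hxf : x ∈ frontier Ω := by
          rw [hopen.frontier_eq]
          exact ⟨hx, hxΩ⟩
        obtain ⟨U, h, hU, hxU, hh, hdh, hiff⟩ := hΩ.exists_mem_closure_iff hxf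
        obtain ⟨g, hg, hgf⟩ := exists_contDiff_eq_of_sublevel hU hxU hh hdh hiff hf
        have hgx : 0 < g x := by
          rw [hgf.self_of_nhds hx]
          exact hpos x hx
        refine ⟨{y | (y ∈ closure Ω → g y = f y) ∧ 0 < g y},
          hgf.and (hg.continuous.continuousAt.eventually_const_lt hgx), g, hg.contDiffOn,
          fun y hy => ?_⟩
        by_cases hyc : y ∈ closure Ω
        · rw [htin y hyc]
          exact hy.1 hyc
        · rw [htout y hyc]
          exact hy.2
    · refine ⟨(closure Ω)ᶜ, isClosed_closure.isOpen_compl.mem_nhds hx, fun _ => 1,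
        contDiffOn_const, fun y hy => ?_⟩
      rw [htout y hy]
      exact zero_lt_one (α := ℝ)
  obtain ⟨g, hg⟩ := exists_contMDiffMap_forall_mem_convex_of_local (n := ⊤)
    (modelWithCornersSelf ℝ (Fin n → ℝ)) htconv fun x => by
      obtain ⟨V, hV, g, hg, hgt⟩ := hloc x
      exact ⟨V, hV, g, hg.contMDiffOn, hgt⟩
  refine ⟨g, g.contMDiff.contDiff, fun x => ?_, fun x hx => ?_⟩
  · have := hg x
    by_cases hx : x ∈ closure Ω
    · rw [htin x hx, mem_singleton_iff] at this
      rw [this]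
      exact hpos x hx
    · rwa [htout x hx] at this
  · have := hg x
    rwa [htin x hx] at this

section Primitive

theorem contDiff_nat_intervalIntegral.{u} {E : Type u} [NormedAddCommGroup E] [NormedSpace ℝ E]
    [ProperSpace E] (n : ℕ) : ∀ {F : Type u} [NormedAddCommGroup F] [NormedSpace ℝ F]
    [CompleteSpace F] {g : E × ℝ → F} (_ : ContDiff ℝ n g) (a b : ℝ),
    ContDiff ℝ n fun x => ∫ s in a..b, g (x, s) := by
  induction n with
  | zero =>
    intro F _ _ _ g hg a b
    rw [Nat.cast_zero, contDiff_zero] at hg ⊢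
    exact intervalIntegral.continuous_parametric_intervalIntegral_of_continuous'
      (f := fun x s => g (x, s)) hg a b
  | succ n ih =>
    intro F _ _ _ g hg a b
    have hg' : ContDiff ℝ ((n : WithTop ℕ∞) + 1) g := by exact_mod_cast hg
    let g' : E × ℝ → E →L[ℝ] F := fun z => (fderiv ℝ g z).comp (ContinuousLinearMap.inl ℝ E ℝ)
    have hdiff : Differentiable ℝ g := hg'.differentiable (by simp)
    have hg'c : ContDiff ℝ n g' := (hg'.fderiv_right le_rfl).clm_comp contDiff_const
    rw [Nat.cast_succ, contDiff_succ_iff_hasFDerivAt]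
    refine ⟨_, ih hg'c a b, fun x => ?_⟩
    obtain ⟨C, hC⟩ := ((isCompact_closedBall x 1).prod
      (isCompact_uIcc (a := a) (b := b))).exists_bound_of_continuousOn hg'c.continuous.continuousOn
    refine intervalIntegral.hasFDerivAt_integral_of_dominated_of_fderiv_le (𝕜 := ℝ)
      (F := fun x s => g (x, s)) (F' := fun x s => g' (x, s)) (bound := fun _ => C)
      (Metric.closedBall_mem_nhds x one_pos) (.of_forall fun y => ?_) ?_ ?_ ?_ ?_ ?_
    · exact (hg.continuous.comp (by fun_prop)).aestronglyMeasurable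
    · exact (hg.continuous.comp (by fun_prop)).intervalIntegrable _ _
    · exact (hg'c.continuous.comp (by fun_prop)).aestronglyMeasurable
    · exact .of_forall fun s hs y hy => hC (y, s) ⟨hy, uIoc_subset_uIcc hs⟩
    · exact intervalIntegrable_const
    · refine .of_forall fun s _ y _ => ?_
      exact (hdiff (y, s)).hasFDerivAt.comp y (hasFDerivAt_prodMk_left y s)

theorem ContDiff.intervalIntegral_prodMk.{u} {E F : Type u} [NormedAddCommGroup E]
    [NormedSpace ℝ E] [ProperSpace E] [NormedAddCommGroup F] [NormedSpace ℝ F] [CompleteSpace F]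
    {g : E × ℝ → F} (hg : ContDiff ℝ (⊤ : ℕ∞) g) (a b : ℝ) :
    ContDiff ℝ (⊤ : ℕ∞) fun x => ∫ s in a..b, g (x, s) :=
  contDiff_infty.2 fun n => contDiff_nat_intervalIntegral n (contDiff_infty.1 hg n) a b

/-- A smooth function has a smooth primitive along any given nonzero direction. -/
theorem exists_contDiff_hasDerivAt_add_smul {E : Type} [NormedAddCommGroup E] [NormedSpace ℝ E]
    [ProperSpace E] {τ : E →L[ℝ] ℝ} {e : E} (he : τ e = 1) {g : E → ℝ}
    (hg : ContDiff ℝ (⊤ : ℕ∞) g) :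
    ∃ Φ : E → ℝ, ContDiff ℝ (⊤ : ℕ∞) Φ ∧
      ∀ (x : E) (r : ℝ), HasDerivAt (fun r => Φ (x + r • e)) (g (x + r • e)) r := by
  refine ⟨fun x => τ x * ∫ s in (0 : ℝ)..1, g (x + ((s - 1) * τ x) • e), ?_, fun x r => ?_⟩
  · refine τ.contDiff.mul (ContDiff.intervalIntegral_prodMk
      (g := fun z : E × ℝ => g (z.1 + ((z.2 - 1) * τ z.1) • e)) (hg.comp ?_) 0 1)
    have : ContDiff ℝ (⊤ : ℕ∞) fun z : E × ℝ => τ z.1 := τ.contDiff.comp contDiff_fst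
    fun_prop
  · have hcont : Continuous fun t : ℝ => g (x + (t - τ x) • e) :=
      hg.continuous.comp (by fun_prop)
    have heq : (fun r : ℝ => τ (x + r • e) *
        ∫ s in (0 : ℝ)..1, g (x + r • e + ((s - 1) * τ (x + r • e)) • e))
        = fun r => ∫ t in (0 : ℝ)..(τ x + r), g (x + (t - τ x) • e) := by
      funext r
      have h1 : τ (x + r • e) = τ x + r := by simp [he]
      have h2 : ∀ s : ℝ, x + r • e + ((s - 1) * (τ x + r)) • e
          = x + (s * (τ x + r) - τ x) • e := fun s => by
        rw [add_assoc, ← add_smul]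
        congr 2
        ring
      simp_rw [h1, h2]
      rw [intervalIntegral.mul_integral_comp_mul_right (f := fun t => g (x + (t - τ x) • e))]
      simp
    rw [heq]
    have h3 := (hcont.integral_hasStrictDerivAt 0 (τ x + r)).hasDerivAt.comp_const_add (τ x) r
    simpa using h3

end Primitive

/-- Dacorogna–Moser normalization of the metric determinant: if `ρ` is a smooth field of
symmetric positive definite matrices on `Ω̄` (a Riemannian metric in the coordinates on
`Ω`), then there is a smooth diffeomorphism `T` of `Ω̄` onto its image whose Jacobian
determinant equals `√(det ρ)` on `Ω`; consequently the transformed metric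
`ρ̃ = (DT⁻¹)ᵀ ρ (DT⁻¹)` has determinant identically one on `T(Ω)`. -/
theorem stmt19 (n : ℕ) (hn : 2 ≤ n) (Ω : Set (Fin n → ℝ))
    (hopen : IsOpen Ω) (hbdd : Bornology.IsBounded Ω) (hne : Ω.Nonempty)
    (hsmooth : HasSmoothBoundary Ω)
    (ρ : (Fin n → ℝ) → Matrix (Fin n) (Fin n) ℝ)
    (hρreg : ∀ i j, ContDiffOn ℝ (⊤ : ℕ∞) (fun x => ρ x i j) (closure Ω))
    (hρpos : ∀ x ∈ closure Ω, (ρ x).PosDef) :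
    ∃ T : (Fin n → ℝ) → (Fin n → ℝ),
      ContDiffOn ℝ (⊤ : ℕ∞) T (closure Ω) ∧ Set.InjOn T (closure Ω) ∧
      (∀ x ∈ Ω, LinearMap.det ((fderiv ℝ T x).toLinearMap) = Real.sqrt ((ρ x).det)) ∧
      (∀ x ∈ Ω,
        (((LinearMap.toMatrix' (fderiv ℝ T x).toLinearMap)⁻¹)ᵀ * ρ x *
          (LinearMap.toMatrix' (fderiv ℝ T x).toLinearMap)⁻¹).det = 1) := by
  have hdet : ContDiffOn ℝ (⊤ : ℕ∞) (fun x => (ρ x).det) (closure Ω) := by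
    simp_rw [Matrix.det_apply]
    exact ContDiffOn.sum fun σ _ => (contDiffOn_prod fun i _ => hρreg _ _).const_smul _
  have hdetpos : ∀ x ∈ closure Ω, 0 < (ρ x).det := fun x hx => (hρpos x hx).det_pos
  obtain ⟨g, hg, hgpos, hgeq⟩ := hsmooth.exists_contDiff_pos_eqOn hopen
    (f := fun x => √(ρ x).det) (hdet.sqrt fun x hx => (hdetpos x hx).ne')
    fun x hx => Real.sqrt_pos.2 (hdetpos x hx)
  let i₀ : Fin n := ⟨0, by omega⟩
  let τ : (Fin n → ℝ) →L[ℝ] ℝ := ContinuousLinearMap.proj i₀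
  let e : Fin n → ℝ := Pi.single i₀ 1
  have he : τ e = 1 := by simp [τ, e]
  obtain ⟨Φ, hΦ, hΦg⟩ := exists_contDiff_hasDerivAt_add_smul he hg
  let T : (Fin n → ℝ) → (Fin n → ℝ) := fun x => x + (Φ x - τ x) • e
  have hτT : ∀ x, τ (T x) = Φ x := fun x => by simp [T, he]
  have hdetT : ∀ x, LinearMap.det (fderiv ℝ T x).toLinearMap = g x := by
    intro x
    have hΦd : HasFDerivAt Φ (fderiv ℝ Φ x) x := (hΦ.differentiable (by simp) x).hasFDerivAt
    have hΦe : fderiv ℝ Φ x e = g x := by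
      have h1 := hΦd.hasLineDerivAt e
      have h2 := hΦg x 0
      rw [zero_smul, add_zero] at h2
      exact HasDerivAt.unique h1 h2
    have hT' : HasFDerivAt T (ContinuousLinearMap.id ℝ _ + (fderiv ℝ Φ x - τ).smulRight e) x :=
      (hasFDerivAt_id x).add ((hΦd.sub τ.hasFDerivAt).smul_const e)
    have h3 : (fderiv ℝ T x).toLinearMap
        = LinearMap.transvection (fderiv ℝ Φ x - τ).toLinearMap e := by
      rw [hT'.fderiv]
      ext v
      simp [LinearMap.transvection.apply]
    rw [h3, LinearMap.transvection.det]
    simp [hΦe, he]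
  have hdetΩ : ∀ x ∈ Ω, LinearMap.det (fderiv ℝ T x).toLinearMap = √(ρ x).det := fun x hx => by
    rw [hdetT x, hgeq (subset_closure hx)]
  refine ⟨T, ?_, ?_, hdetΩ, fun x hx => ?_⟩
  · exact (contDiff_id.add ((hΦ.sub τ.contDiff).smul contDiff_const)).contDiffOn
  · intro x _ y _ hxy
    have hmono : StrictMono fun r : ℝ => Φ (x + r • e) :=
      strictMono_of_hasDerivAt_pos (fun r => hΦg x r) fun r => hgpos _
    have hy : y = x + ((Φ x - τ x) - (Φ y - τ y)) • e := by
      have hxy' : x + (Φ x - τ x) • e = y + (Φ y - τ y) • e := hxy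
      rw [sub_smul, ← add_sub_assoc, hxy', add_sub_cancel_right]
    have hΦxy : Φ x = Φ y := by rw [← hτT, ← hτT, hxy]
    have h0 : (0 : ℝ) = (Φ x - τ x) - (Φ y - τ y) := by
      refine hmono.injective ?_
      simp only [zero_smul, add_zero]
      rw [← hy, hΦxy]
    rw [← h0, zero_smul, add_zero] at hy
    exact hy.symm
  · have hpos := hdetpos x (subset_closure hx)
    rw [Matrix.det_mul, Matrix.det_mul, Matrix.det_transpose, Matrix.det_nonsing_inv,
      LinearMap.det_toMatrix', hdetΩ x hx, Ring.inverse_eq_inv']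
    have hs : √(ρ x).det ≠ 0 := (Real.sqrt_pos.2 hpos).ne'
    field_simp
    rw [Real.sq_sqrt hpos.le]
end
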